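/- Let X be a shift space with language 𝓛 = 𝓛(X), let φ : X → ℝ be strictly positive and continuous, and let dim_φ denote Hausdorff dimension with respect to the metric d_φ. Suppose 𝓖 ⊂ 𝓛 has (W)-specification and 𝓛 is edit approachable by 𝓖. Then for any continuous ψ : X → ℝ, either the irregular set X̂(ψ) = {x ∈ X : lim_{n→∞} (1/n)∑_{i=0}^{n−1} ψ(σ^i x) does not exist} is empty, or dim_φ(X̂(ψ)) = dim_φ(X). -/

import Mathlib

open MeasureTheory Filter Topology Set
open scoped ENNReal Classical

namespace Paper

variable {A : Type} [Fintype A] [DecidableEq A] [TopologicalSpace A] [DiscreteTopology A]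
  [MeasurableSpace A] [BorelSpace A]

/-- The left shift map on the full shift `A^ℕ`. -/
def shift : (ℕ → A) → (ℕ → A) := fun x i => x (i + 1)

/-- The cylinder set of a finite word `w`: points whose initial word is `w`. -/
def cylinder (w : List A) : Set (ℕ → A) := {x | ∀ i : Fin w.length, x i = w.get i}

/-- The language of `X`: finite words `w` with `[w] ∩ X ≠ ∅`. -/
def language (X : Set (ℕ → A)) : Set (List A) := {w | (cylinder w ∩ X).Nonempty}

/-- One edit of a word: a substitution, an insertion, or a deletion. -/
def EditStep (w w' : List A) : Prop :=
  (∃ u₁ u₂ : List A, ∃ a a' : A, w = u₁ ++ [a] ++ u₂ ∧ w' = u₁ ++ [a'] ++ u₂) ∨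
  (∃ u₁ u₂ : List A, ∃ a' : A, w = u₁ ++ u₂ ∧ w' = u₁ ++ [a'] ++ u₂) ∨
  (∃ u₁ u₂ : List A, ∃ a : A, w = u₁ ++ [a] ++ u₂ ∧ w' = u₁ ++ u₂)

/-- The edit distance: the minimal number of edits transforming `v` into `w`. -/
noncomputable def editDist (v w : List A) : ℕ :=
  sInf {n | ∃ f : ℕ → List A, f 0 = v ∧ f n = w ∧ ∀ i < n, EditStep (f i) (f (i + 1))}

/-- `G ⊆ L` has (W)-specification (with some gap length `τ`). -/
def HasSpecW (L G : Set (List A)) : Prop :=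
  ∃ τ : ℕ, ∀ v ∈ G, ∀ w ∈ G, ∃ u ∈ L, u.length ≤ τ ∧ v ++ u ++ w ∈ G

/-- A mistake function: nondecreasing with `g n / n → 0`. -/
def MistakeFun (g : ℕ → ℕ) : Prop :=
  Monotone g ∧ Tendsto (fun n => (g n : ℝ) / n) atTop (𝓝 0)

/-- `L` is edit approachable by `G`. -/
def EditApproachable (L G : Set (List A)) : Prop :=
  ∃ g : ℕ → ℕ, MistakeFun g ∧ ∀ w ∈ L, ∃ v ∈ G, editDist v w ≤ g w.length

/-- The shift map restricted to a (shift-invariant) subset `X`, as a self-map of `↥X`. -/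
noncomputable def subShift (X : Set (ℕ → A)) : ↥X → ↥X := fun x =>
  if h : shift x.val ∈ X then ⟨shift x.val, h⟩ else x

/-- Birkhoff sum `S_n φ = ∑_{i<n} φ ∘ σ^i`. -/
def birkhoff {Y : Type*} (σ : Y → Y) (φ : Y → ℝ) (n : ℕ) (y : Y) : ℝ :=
  ∑ i ∈ Finset.range n, φ (σ^[i] y)

/-- The Birkhoff average `(1/n) S_n φ`. -/
noncomputable def birkAvg {Y : Type*} (σ : Y → Y) (φ : Y → ℝ) (n : ℕ) (y : Y) : ℝ :=
  (n : ℝ)⁻¹ * birkhoff σ φ n y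

/-- Carathéodory sum `M(Z,t,φ,N)` over covers of `Z` by cylinders of length `> N`. -/
noncomputable def Mcal (X : Set (ℕ → A)) (φ : ↥X → ℝ) (Z : Set ↥X) (t : ℝ) (N : ℕ) : ℝ≥0∞ :=
  ⨅ (S : Set (List A)) (_ : S.Countable) (_ : ∀ w ∈ S, N < w.length)
    (_ : Z ⊆ ⋃ w ∈ S, Subtype.val ⁻¹' cylinder w),
    ∑' w : S, ENNReal.ofReal (Real.exp (-t * (w : List A).length +
      sSup (birkhoff (subShift X) φ (w : List A).length ''
        (Subtype.val ⁻¹' cylinder (w : List A)))))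

/-- `M(Z,t,φ) = lim_{N→∞} M(Z,t,φ,N)` (the limit of a nondecreasing quantity). -/
noncomputable def McalLim (X : Set (ℕ → A)) (φ : ↥X → ℝ) (Z : Set ↥X) (t : ℝ) : ℝ≥0∞ :=
  ⨆ N : ℕ, Mcal X φ Z t N

/-- The topological pressure `P_Z(φ)` of `Z ⊆ X`. -/
noncomputable def pressure (X : Set (ℕ → A)) (φ : ↥X → ℝ) (Z : Set ↥X) : ℝ :=
  sInf {t : ℝ | McalLim X φ Z t = 0}

/-- The empirical measure `ℰ_n(x) = (1/n) ∑_{i<n} δ_{σ^i x}`. -/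
noncomputable def empiric {Y : Type*} [MeasurableSpace Y] (σ : Y → Y) (n : ℕ) (x : Y) :
    Measure Y := (n : ℝ≥0∞)⁻¹ • ∑ i ∈ Finset.range n, Measure.dirac (σ^[i] x)

/-- The set `A(ℰ_n(x))` of weak* limit points of the sequence of empirical measures of `x`:
probability measures that are limits of the empirical measures along a subsequence. -/
def limitPts {Y : Type*} [MeasurableSpace Y] [TopologicalSpace Y] (σ : Y → Y) (x : Y) :
    Set (ProbabilityMeasure Y) :=
  {μ | ∃ φ : ℕ → ℕ, StrictMono φ ∧ ∀ f : C(Y, ℝ),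
      Tendsto (fun k => birkAvg σ (fun y => f y) (φ k) x) atTop (𝓝 (∫ y, f y ∂μ.toMeasure))}

/-- The saturated set `G_K = {x : A(ℰ_n(x)) = K}`. -/
def saturated {Y : Type*} [MeasurableSpace Y] [TopologicalSpace Y] (σ : Y → Y)
    (K : Set (ProbabilityMeasure Y)) : Set Y := {x | limitPts σ x = K}

/-- The generic points of `μ`: those `x` with `ℰ_n(x) → μ` in the weak* topology. -/
def genericPts {Y : Type*} [MeasurableSpace Y] [TopologicalSpace Y] (σ : Y → Y)
    (μ : ProbabilityMeasure Y) : Set Y :=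
  {x | ∀ f : C(Y, ℝ),
      Tendsto (fun n => birkAvg σ (fun y => f y) n x) atTop (𝓝 (∫ y, f y ∂μ.toMeasure))}

/-- `μ` is a `σ`-invariant (probability) measure. -/
def IsInvariant {Y : Type*} [MeasurableSpace Y] (σ : Y → Y) (μ : ProbabilityMeasure Y) : Prop :=
  μ.toMeasure.map σ = μ.toMeasure

/-- The level set `X(ψ,α)` of points whose Birkhoff averages of `ψ` converge to `α`. -/
def levelSet {Y : Type*} (σ : Y → Y) (ψ : Y → ℝ) (α : ℝ) : Set Y :=
  {x | Tendsto (fun n => birkAvg σ ψ n x) atTop (𝓝 α)}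

/-- The irregular set `X̂(ψ)` of points whose Birkhoff averages of `ψ` do not converge. -/
def irregular {Y : Type*} (σ : Y → Y) (ψ : Y → ℝ) : Set Y :=
  {x | ¬ ∃ α : ℝ, Tendsto (fun n => birkAvg σ ψ n x) atTop (𝓝 α)}

/-- The cylinder of a word of length `n` given as `w : Fin n → A`. -/
def cylF {n : ℕ} (w : Fin n → A) : Set (ℕ → A) := {x | ∀ i : Fin n, x i = w i}

/-- The entropy `H_n(μ)` of the partition of `X` into cylinders of length `n`. -/
noncomputable def wordEntropy (X : Set (ℕ → A)) (μ : ProbabilityMeasure ↥X) (n : ℕ) : ℝ :=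
  ∑ w : Fin n → A, Real.negMulLog ((μ.toMeasure (Subtype.val ⁻¹' cylF w)).toReal)

/-- The measure-theoretic (Kolmogorov–Sinai) entropy `h_μ(σ)` of a shift-invariant measure on a
subshift: by subadditivity, `lim_n H_n/n = inf_{n ≥ 1} H_n/n`. -/
noncomputable def entropy (X : Set (ℕ → A)) (μ : ProbabilityMeasure ↥X) : ℝ :=
  ⨅ n : ℕ, wordEntropy X μ (n + 1) / (n + 1)

/-- The distance `D` on measures induced by a countable family of continuous functions. -/
noncomputable def Dmetric {Y : Type*} [MeasurableSpace Y] [TopologicalSpace Y]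
    (f : ℕ → C(Y, ℝ)) (μ ν : Measure Y) : ℝ :=
  ∑' k : ℕ, ((2 : ℝ) ^ (k + 1))⁻¹ * |(∫ y, f k y ∂μ) - ∫ y, f k y ∂ν|

/-- The family `f` is separating: `D` separates Borel probability measures. -/
def Separating {Y : Type*} [MeasurableSpace Y] [TopologicalSpace Y] (f : ℕ → C(Y, ℝ)) : Prop :=
  ∀ μ ν : ProbabilityMeasure Y,
    (∀ k, (∫ y, f k y ∂μ.toMeasure) = ∫ y, f k y ∂ν.toMeasure) → μ = ν

/-- Diameter of a set with respect to a distance function `d`, valued in `ℝ≥0∞`. -/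
noncomputable def ediam {Y : Type*} (d : Y → Y → ℝ) (U : Set Y) : ℝ≥0∞ :=
  ⨆ x ∈ U, ⨆ y ∈ U, ENNReal.ofReal (d x y)

/-- The `s`-dimensional Hausdorff pre-measure at scale `ε` w.r.t. the distance `d`. -/
noncomputable def hMeasAux {Y : Type*} (d : Y → Y → ℝ) (s : ℝ) (ε : ℝ≥0∞) (Z : Set Y) : ℝ≥0∞ :=
  ⨅ (C : ℕ → Set Y) (_ : Z ⊆ ⋃ n, C n) (_ : ∀ n, ediam d (C n) ≤ ε),
    ∑' n, ⨆ (_ : (C n).Nonempty), ediam d (C n) ^ s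

/-- The `s`-dimensional Hausdorff measure w.r.t. the distance `d`. -/
noncomputable def hMeas {Y : Type*} (d : Y → Y → ℝ) (s : ℝ) (Z : Set Y) : ℝ≥0∞ :=
  ⨆ (ε : ℝ≥0∞) (_ : 0 < ε), hMeasAux d s ε Z

/-- The Hausdorff dimension of `Z` w.r.t. the distance `d`. -/
noncomputable def hdim {Y : Type*} (d : Y → Y → ℝ) (Z : Set Y) : ℝ :=
  sInf {s : ℝ | 0 ≤ s ∧ hMeas d s Z = 0}

/-- The length `|x ∧ y|` of the longest common prefix of two distinct points. -/
noncomputable def wedge (x y : ℕ → A) : ℕ := sInf {n | x n ≠ y n}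

/-- The Gatzouras–Peres distance `d_φ` associated with a strictly positive continuous `φ`. -/
noncomputable def dphi (X : Set (ℕ → A)) (φ : ↥X → ℝ) (x y : ↥X) : ℝ :=
  if x = y then 0
  else Real.exp (-(sSup (birkhoff (subShift X) φ (wedge x.val y.val) ''
      {z : ↥X | ∀ i < wedge x.val y.val, z.val i = x.val i})))

/-- The word `w` occurs in `x` at position `k`. -/
def occursAt (w : List A) (x : ℕ → A) (k : ℕ) : Prop :=
  ∀ i : Fin w.length, x (k + i) = w.get i

/-- A shift of finite type: determined by a finite set of forbidden words. -/
def IsSFT {B : Type} (Z : Set (ℕ → B)) : Prop :=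
  ∃ F : Set (List B), F.Finite ∧ Z = {x | ∀ w ∈ F, ∀ k, ¬ occursAt w x k}

/-- A sofic shift: the image of a shift of finite type under a sliding block code. -/
def IsSofic (Y : Set (ℕ → A)) : Prop :=
  ∃ (B : Type) (_ : Fintype B) (Z : Set (ℕ → B)) (π : (ℕ → B) → (ℕ → A)),
    IsSFT Z ∧ Set.MapsTo shift Z Z ∧
    (∃ r : ℕ, ∀ z ∈ Z, ∀ z' ∈ Z, ∀ k, (∀ i ≤ k + r, z i = z' i) → π z k = π z' k) ∧
    (∀ z ∈ Z, π (shift z) = shift (π z)) ∧ π '' Z = Y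

/-- Topological transitivity of a subshift, via its language. -/
def IsTransitive (Y : Set (ℕ → A)) : Prop :=
  ∀ u ∈ language Y, ∀ v ∈ language Y, ∃ w : List A, u ++ w ++ v ∈ language Y

/-- The prefix of length `n` of `x`, as a word. -/
def prefixWord (x : ℕ → A) (n : ℕ) : List A := List.ofFn fun i : Fin n => x i

/-- The norm `‖m‖ = sup_{0 < ‖f‖ ≤ 1} |∫ f dm| / ‖f‖` of a measure on a compact space. -/
noncomputable def mnorm {Y : Type*} [TopologicalSpace Y] [CompactSpace Y] [MeasurableSpace Y]
    (m : Measure Y) : ℝ :=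
  sSup ((fun f : C(Y, ℝ) => |∫ y, f y ∂m| / ‖f‖) '' {f : C(Y, ℝ) | 0 < ‖f‖ ∧ ‖f‖ ≤ 1})

/-- Strict lexicographic order on `ℕ`-indexed sequences of naturals. -/
def lexLt (x y : ℕ → ℕ) : Prop := ∃ n : ℕ, (∀ i < n, x i = y i) ∧ x n < y n

/-- The β-shift: all sequences over `{0, …, b-1}` all of whose shifts are lexicographically
below the expansion `w` of `1` in base `β` (where `b = ⌈β⌉`). -/
def betaShift (b : ℕ) (w : ℕ → ℕ) : Set (ℕ → Fin b) :=
  {x | ∀ j : ℕ, 1 ≤ j → lexLt (fun i => ((shift^[j] x) i : ℕ)) w}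

/-- The S-gap shift: sequences over `{0,1}` such that the number of `0`s between any two
consecutive `1`s lies in `S`. -/
def sGapShift (S : Set ℕ) : Set (ℕ → Fin 2) :=
  {x | ∀ k l : ℕ, k < l → x k = 1 → x l = 1 →
    (∀ m : ℕ, k < m → m < l → x m = 0) → l - k - 1 ∈ S}

section EditDistance

variable {B : Type}

/-- There is a chain of `n` edits from `v` to `w`. -/
def EditChain (n : ℕ) (v w : List B) : Prop :=
  ∃ f : ℕ → List B, f 0 = v ∧ f n = w ∧ ∀ i < n, EditStep (f i) (f (i + 1))

lemma EditChain.cons {n : ℕ} {v v' w : List B} (h : EditStep v v') (h' : EditChain n v' w) :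
    EditChain (n + 1) v w := by
  obtain ⟨f, h0, hn, hf⟩ := h'
  refine ⟨fun i => Nat.casesOn i v f, rfl, hn, ?_⟩
  rintro (_ | i) hi
  · simpa [h0] using h
  · exact hf i (by omega)

lemma exists_editChain_append (w v : List B) : ∃ n, EditChain n v (v ++ w) := by
  induction w generalizing v with
  | nil => exact ⟨0, fun _ => v, rfl, by simp, by simp⟩
  | cons a w ih =>
    obtain ⟨n, hn⟩ := ih (v ++ [a])
    refine ⟨n + 1, EditChain.cons (v' := v ++ [a]) (Or.inr (Or.inl ⟨v, [], a, by simp, by simp⟩)) ?_⟩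
    simpa using hn

lemma exists_editChain (v w : List B) : ∃ n, EditChain n v w := by
  induction v with
  | nil => simpa using exists_editChain_append w []
  | cons a v ih =>
    obtain ⟨n, hn⟩ := ih
    exact ⟨n + 1, hn.cons (Or.inr (Or.inr ⟨[], v, a, by simp, by simp⟩))⟩

lemma editChain_editDist (v w : List B) : EditChain (editDist v w) v w :=
  Nat.sInf_mem (s := {n | EditChain n v w}) (exists_editChain v w)

/-- A function varying by at most `K` under one edit is `K`-Lipschitz for the edit distance. -/
lemma abs_sub_le_editDist {F : List B → ℝ} {K : ℝ}
    (hF : ∀ v w, EditStep v w → |F v - F w| ≤ K) (v w : List B) :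
    |F v - F w| ≤ K * editDist v w := by
  obtain ⟨f, h0, hn, hf⟩ := editChain_editDist v w
  have key : ∀ i ≤ editDist v w, |F v - F (f i)| ≤ K * i := by
    intro i
    induction i with
    | zero => simp [h0]
    | succ i ih =>
      intro hi
      have h1 := ih (by omega)
      have h2 := hF _ _ (hf i (by omega))
      have h3 := abs_sub_le (F v) (F (f i)) (F (f (i + 1)))
      push_cast
      linarith
  simpa [hn] using key _ le_rfl

lemma EditStep.abs_length_sub_le {v w : List B} (h : EditStep v w) :
    |(v.length : ℝ) - w.length| ≤ 1 := by
  rcases h with ⟨u₁, u₂, a, a', rfl, rfl⟩ | ⟨u₁, u₂, a, rfl, rfl⟩ | ⟨u₁, u₂, a, rfl, rfl⟩ <;>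
    simp only [List.length_append, List.length_cons, List.length_nil] <;> push_cast <;>
    rw [abs_le] <;> constructor <;> linarith

lemma abs_length_sub_le_editDist (v w : List B) :
    |(v.length : ℝ) - w.length| ≤ editDist v w := by
  simpa using abs_sub_le_editDist (F := fun l : List B => (l.length : ℝ))
    (fun v w h => h.abs_length_sub_le) v w

/-- `v` and `w` have a common subword from which they differ by at most `j` letters in total. -/
def HasCommonSubword (j : ℕ) (v w : List B) : Prop :=
  ∃ c : List B, c.Sublist v ∧ c.Sublist w ∧ v.length + w.length ≤ 2 * c.length + j

lemma HasCommonSubword.editStep {j : ℕ} {v w w' : List B} (h : HasCommonSubword j v w)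
    (hs : EditStep w w') : HasCommonSubword (j + 2) v w' := by
  obtain ⟨c, hv, hw, hl⟩ := h
  rcases hs with ⟨u₁, u₂, a, a', rfl, rfl⟩ | ⟨u₁, u₂, a, rfl, rfl⟩ | ⟨u₁, u₂, a, rfl, rfl⟩
  · obtain ⟨c', c₃, rfl, h', h₃⟩ := List.sublist_append_iff.1 hw
    obtain ⟨c₁, c₂, rfl, h₁, h₂⟩ := List.sublist_append_iff.1 h'
    refine ⟨c₁ ++ c₃, List.Sublist.trans ?_ hv, ?_, ?_⟩
    · exact (List.sublist_append_left c₁ c₂).append_right c₃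
    · exact (h₁.trans (List.sublist_append_left _ _)).append h₃
    · have := h₂.length_le
      simp only [List.length_append, List.length_cons, List.length_nil] at *
      omega
  · obtain ⟨c₁, c₂, rfl, h₁, h₂⟩ := List.sublist_append_iff.1 hw
    refine ⟨c₁ ++ c₂, hv, (h₁.trans (List.sublist_append_left _ _)).append h₂, ?_⟩
    simp only [List.length_append, List.length_cons, List.length_nil] at *
    omega
  · obtain ⟨c', c₃, rfl, h', h₃⟩ := List.sublist_append_iff.1 hw
    obtain ⟨c₁, c₂, rfl, h₁, h₂⟩ := List.sublist_append_iff.1 h'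
    refine ⟨c₁ ++ c₃, List.Sublist.trans ?_ hv, h₁.append h₃, ?_⟩
    · exact (List.sublist_append_left c₁ c₂).append_right c₃
    · have := h₂.length_le
      simp only [List.length_append, List.length_cons, List.length_nil] at *
      omega

lemma hasCommonSubword_editDist (v w : List B) : HasCommonSubword (2 * editDist v w) v w := by
  obtain ⟨f, h0, hn, hf⟩ := editChain_editDist v w
  have key : ∀ i ≤ editDist v w, HasCommonSubword (2 * i) v (f i) := by
    intro i
    induction i with
    | zero => exact fun _ => ⟨v, List.Sublist.refl _, by rw [h0], by rw [h0]; omega⟩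
    | succ i ih => exact fun hi => (ih (by omega)).editStep (hf i (by omega))
  have := key _ le_rfl
  rwa [hn] at this

lemma HasCommonSubword.mono {j k : ℕ} {v w : List B} (h : HasCommonSubword j v w) (hjk : j ≤ k) :
    HasCommonSubword k v w := by
  obtain ⟨c, hv, hw, hl⟩ := h
  exact ⟨c, hv, hw, by omega⟩

/-- The last letters to be matched, inserted or deleted in an alignment of two words. -/
lemma HasCommonSubword.cons_cons {j : ℕ} {a b : B} {v w : List B}
    (h : HasCommonSubword j (a :: v) (b :: w)) :
    (b = a ∧ HasCommonSubword j v w) ∨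
      ∃ i, j = i + 1 ∧ (HasCommonSubword i (a :: v) w ∨ HasCommonSubword i v (b :: w)) := by
  obtain ⟨c, hv, hw, hl⟩ := h
  simp only [List.length_cons] at hl
  rcases List.sublist_cons_iff.1 hv with hv' | ⟨r, rfl, hr⟩
  · have h1 := hv'.length_le
    have h2 := hw.length_le
    simp only [List.length_cons] at h2
    exact Or.inr ⟨j - 1, by omega, Or.inr ⟨c, hv', hw, by simp only [List.length_cons]; omega⟩⟩
  · rcases List.cons_sublist_cons'.1 hw with hw' | ⟨rfl, hw'⟩
    · have h1 := hv.length_le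
      have h2 := hw'.length_le
      simp only [List.length_cons] at h1 h2 hl
      exact Or.inr ⟨j - 1, by omega, Or.inl ⟨_, hv, hw', by simp only [List.length_cons]; omega⟩⟩
    · refine Or.inl ⟨rfl, r, hr, hw', ?_⟩
      simp only [List.length_cons] at hl
      omega

lemma HasCommonSubword.nil_cons {j : ℕ} {b : B} {w : List B}
    (h : HasCommonSubword j [] (b :: w)) : ∃ i, j = i + 1 ∧ HasCommonSubword i [] w := by
  obtain ⟨c, hv, hw, hl⟩ := h
  obtain rfl := List.sublist_nil.1 hv
  simp only [List.length_cons, List.length_nil] at hl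
  exact ⟨j - 1, by omega, [], List.Sublist.refl _, List.nil_sublist _, by simp; omega⟩

lemma exists_finset_hasCommonSubword [Fintype B] {T : ℝ} (hT : 1 ≤ T) (N : ℕ) :
    ∀ (v : List B) (n j : ℕ), v.length + n ≤ N → ∃ F : Finset (List B),
      (∀ w : List B, w.length = n → HasCommonSubword j v w → w ∈ F) ∧
      (F.card : ℝ) ≤ T ^ j * (1 + (Fintype.card B + 1) / T) ^ (v.length + n) := by
  set b : ℝ := (Fintype.card B : ℝ) with hb
  set l : ℝ := 1 + (b + 1) / T with hl
  have hl1 : 1 ≤ l := by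
    have : 0 ≤ (b + 1) / T := by positivity
    linarith
  have hlT : T * l = T + b + 1 := by rw [hl]; field_simp; ring
  have hone : ∀ i k : ℕ, 1 ≤ T ^ i * l ^ k := fun i k =>
    one_le_mul_of_one_le_of_one_le (one_le_pow₀ hT) (one_le_pow₀ hl1)
  induction N with
  | zero =>
    intro v n j h
    refine ⟨{[]}, fun w hw _ => ?_, by simpa using hone j (v.length + n)⟩
    have : n = 0 := by omega
    subst this
    simpa using hw
  | succ N ih =>
    intro v n j h
    cases n with
    | zero =>
      exact ⟨{[]}, fun w hw _ => by simpa using hw, by simpa using hone j (v.length + 0)⟩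
    | succ n =>
      cases v with
      | nil =>
        cases j with
        | zero =>
          refine ⟨∅, fun w hw hc => ?_, by simp; positivity⟩
          cases w with
          | nil => simp at hw
          | cons x w =>
            obtain ⟨i, hi, -⟩ := hc.nil_cons
            omega
        | succ j =>
          obtain ⟨F, hF, hFc⟩ := ih [] n j (by simp at *; omega)
          refine ⟨Finset.image₂ List.cons Finset.univ F, fun w hw hc => ?_, ?_⟩
          · cases w with
            | nil => simp at hw
            | cons x w =>
              obtain ⟨i, hi, hc'⟩ := hc.nil_cons
              obtain rfl : j = i := by omega
              exact Finset.mem_image₂_of_mem (Finset.mem_univ _) (hF w (by simpa using hw) hc')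
          · have h1 : ((Finset.image₂ List.cons Finset.univ F).card : ℝ) ≤ b * F.card := by
              have := Finset.card_image₂_le List.cons (Finset.univ : Finset B) F
              rw [Finset.card_univ] at this
              rw [hb]
              exact_mod_cast this
            simp only [List.length_nil, zero_add] at hFc ⊢
            calc _ ≤ b * F.card := h1
              _ ≤ b * (T ^ j * l ^ n) := by gcongr
              _ ≤ (T * l) * (T ^ j * l ^ n) := by gcongr; linarith
              _ = _ := by ring
      | cons a v =>
        simp only [List.length_cons] at h
        obtain ⟨F₁, hF₁, hc₁⟩ := ih v n j (by omega)
        cases j with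
        | zero =>
          refine ⟨F₁.image (List.cons a), fun w hw hc => ?_, ?_⟩
          · cases w with
            | nil => simp at hw
            | cons x w =>
              rcases hc.cons_cons with ⟨rfl, hc'⟩ | ⟨i, hi, -⟩
              · exact Finset.mem_image_of_mem _ (hF₁ w (by simpa using hw) hc')
              · omega
          · calc ((F₁.image (List.cons a)).card : ℝ) ≤ F₁.card := by
                  exact_mod_cast Finset.card_image_le
              _ ≤ T ^ 0 * l ^ (v.length + n) := hc₁
              _ ≤ _ := by
                gcongr
                all_goals simp
        | succ j =>
          obtain ⟨F₂, hF₂, hc₂⟩ := ih (a :: v) n j (by simp; omega)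
          obtain ⟨F₃, hF₃, hc₃⟩ := ih v (n + 1) j (by omega)
          refine ⟨F₁.image (List.cons a) ∪ Finset.image₂ List.cons Finset.univ F₂ ∪ F₃,
            fun w hw hc => ?_, ?_⟩
          · cases w with
            | nil => simp at hw
            | cons x w =>
              rcases hc.cons_cons with ⟨rfl, hc'⟩ | ⟨i, hi, hc' | hc'⟩
              · exact Finset.mem_union_left _ (Finset.mem_union_left _
                  (Finset.mem_image_of_mem _ (hF₁ w (by simpa using hw) hc')))
              · obtain rfl : j = i := by omega
                exact Finset.mem_union_left _ (Finset.mem_union_right _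
                  (Finset.mem_image₂_of_mem (Finset.mem_univ _) (hF₂ w (by simpa using hw) hc')))
              · obtain rfl : j = i := by omega
                exact Finset.mem_union_right _ (hF₃ _ hw hc')
          · have h1 : ((F₁.image (List.cons a) ∪ Finset.image₂ List.cons Finset.univ F₂ ∪ F₃).card
                : ℝ) ≤ F₁.card + b * F₂.card + F₃.card := by
              have e1 := Finset.card_union_le (F₁.image (List.cons a) ∪
                Finset.image₂ List.cons Finset.univ F₂) F₃
              have e2 := Finset.card_union_le (F₁.image (List.cons a))
                (Finset.image₂ List.cons Finset.univ F₂)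
              have e3 := Finset.card_image₂_le List.cons (Finset.univ : Finset B) F₂
              have e4 := Finset.card_image_le (s := F₁) (f := List.cons a)
              rw [Finset.card_univ] at e3
              have : (F₁.image (List.cons a) ∪ Finset.image₂ List.cons Finset.univ F₂ ∪ F₃).card ≤
                F₁.card + Fintype.card B * F₂.card + F₃.card := by omega
              rw [hb]
              exact_mod_cast this
            simp only [List.length_cons] at hc₂ ⊢
            have hc₂' : b * F₂.card ≤ b * (T ^ j * l ^ (v.length + 1 + n)) := by gcongr
            have e : v.length + (n + 1) = v.length + 1 + n := by ring
            rw [e] at hc₃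
            calc _ ≤ T ^ (j + 1) * l ^ (v.length + n) + b * (T ^ j * l ^ (v.length + 1 + n))
                  + T ^ j * l ^ (v.length + 1 + n) := by linarith
              _ = T ^ j * l ^ (v.length + n) * (T + (b + 1) * l) := by ring
              _ ≤ T ^ j * l ^ (v.length + n) * (T * l * l) := by
                gcongr
                rw [hlT]
                nlinarith
              _ = _ := by ring

lemma MistakeFun.eventually_le {g : ℕ → ℕ} (hg : MistakeFun g) {ε : ℝ} (hε : 0 < ε) :
    ∀ᶠ n : ℕ in atTop, (g n : ℝ) ≤ ε * n := by
  filter_upwards [hg.2.eventually_lt_const hε, eventually_gt_atTop 0] with n hn hn0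
  have : (0 : ℝ) < n := by exact_mod_cast hn0
  exact ((div_lt_iff₀ this).1 hn).le

/-- Only subexponentially many words of length `n` are within `g n` edits of a prefix of a
given word. -/
lemma eventually_exists_finset_editDist_prefixes [Fintype B] {g : ℕ → ℕ} (hg : MistakeFun g) {ε : ℝ}
    (hε : 0 < ε) : ∀ᶠ n : ℕ in atTop, ∀ z : List B, ∃ F : Finset (List B),
      (∀ w v : List B, w.length = n → v <+: z → editDist v w ≤ g n → w ∈ F) ∧
      (F.card : ℝ) ≤ Real.exp (ε * n) := by
  set b : ℝ := (Fintype.card B : ℝ)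
  set T : ℝ := max 1 (9 * (b + 1) / ε)
  have hT1 : 1 ≤ T := le_max_left _ _
  have hT0 : 0 < T := by linarith
  have hbT : (b + 1) / T ≤ ε / 9 := by
    have : 9 * (b + 1) / ε ≤ T := le_max_right _ _
    rw [div_le_iff₀ hε] at this
    rw [div_le_iff₀ hT0]
    linarith
  have hlog : 0 ≤ Real.log T := Real.log_nonneg hT1
  have hpos : 0 < ε / (6 * (Real.log T + 1)) := by positivity
  have hexp : ∀ᶠ n : ℕ in atTop, (2 * n + 1 : ℝ) ≤ Real.exp (ε / 3 * n) := by
    have h1 : Tendsto (fun n : ℕ => ε / 3 * (n : ℝ)) atTop atTop :=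
      tendsto_natCast_atTop_atTop.const_mul_atTop (by positivity)
    have h2 := (Real.tendsto_exp_div_pow_atTop 1).comp h1
    filter_upwards [h2.eventually_ge_atTop (9 / ε), eventually_ge_atTop 1] with n hn hn1
    have hn1' : (1 : ℝ) ≤ n := by exact_mod_cast hn1
    simp only [Function.comp, pow_one] at hn
    rw [le_div_iff₀ (by positivity)] at hn
    have : 9 / ε * (ε / 3 * n) = 3 * n := by field_simp; norm_num
    linarith
  filter_upwards [hg.eventually_le one_pos, hg.eventually_le hpos, hexp] with n hg1 hg2 hn z
  choose F hF hFc using fun t : ℕ => exists_finset_hasCommonSubword (B := B) hT1 _ (z.take t) n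
    (2 * g n) le_rfl
  refine ⟨(Finset.range (2 * n + 1)).biUnion F, fun w v hw hv hd => ?_, ?_⟩
  · have h1 := (abs_le.1 (abs_length_sub_le_editDist v w)).2
    have h2 : (editDist v w : ℝ) ≤ g n := by exact_mod_cast hd
    have h3 : (v.length : ℝ) ≤ 2 * n := by rw [hw] at h1; linarith
    have h4 : v.length ≤ 2 * n := by exact_mod_cast h3
    refine Finset.mem_biUnion.2 ⟨v.length, Finset.mem_range.2 (by omega), hF _ w hw ?_⟩
    rw [← List.prefix_iff_eq_take.1 hv]
    exact (hasCommonSubword_editDist v w).mono (by omega)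
  · have h1 : ∀ t ∈ Finset.range (2 * n + 1), ((F t).card : ℝ) ≤ Real.exp (2 * ε / 3 * n) := by
      intro t ht
      have ht' : t ≤ 2 * n := by simpa [Nat.lt_succ_iff] using ht
      have hlen : (z.take t).length + n ≤ 3 * n := by
        have := List.length_take_le t z
        omega
      have hl1 : 1 ≤ 1 + (b + 1) / T := by
        have : 0 ≤ (b + 1) / T := by positivity
        linarith
      calc ((F t).card : ℝ) ≤ T ^ (2 * g n) * (1 + (b + 1) / T) ^ ((z.take t).length + n) := hFc t
        _ ≤ T ^ (2 * g n) * (1 + (b + 1) / T) ^ (3 * n) := by gcongr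
        _ ≤ Real.exp (ε / 3 * n) * Real.exp (ε / 3 * n) := by
          gcongr
          · rw [← Real.exp_log hT0, ← Real.exp_nat_mul, Real.exp_le_exp]
            rw [div_mul_eq_mul_div, le_div_iff₀ (by positivity)] at hg2
            push_cast
            nlinarith [Nat.cast_nonneg (α := ℝ) (g n)]
          · calc (1 + (b + 1) / T) ^ (3 * n) ≤ Real.exp (ε / 9) ^ (3 * n) := by
                  gcongr
                  have := Real.add_one_le_exp (ε / 9)
                  linarith
              _ = Real.exp (ε / 3 * n) := by
                rw [← Real.exp_nat_mul]
                push_cast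
                ring_nf
        _ = _ := by rw [← Real.exp_add]; ring_nf
    calc (((Finset.range (2 * n + 1)).biUnion F).card : ℝ)
        ≤ ∑ t ∈ Finset.range (2 * n + 1), ((F t).card : ℝ) := by
          exact_mod_cast Finset.card_biUnion_le
      _ ≤ ∑ _t ∈ Finset.range (2 * n + 1), Real.exp (2 * ε / 3 * n) := Finset.sum_le_sum h1
      _ = (2 * n + 1) * Real.exp (2 * ε / 3 * n) := by simp
      _ ≤ Real.exp (ε / 3 * n) * Real.exp (2 * ε / 3 * n) := by gcongr
      _ = _ := by rw [← Real.exp_add]; ring_nf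

end EditDistance

section Shift

variable {B : Type}

lemma mem_cylinder_iff {w : List B} {x : ℕ → B} :
    x ∈ cylinder w ↔ ∀ (i : ℕ) (h : i < w.length), x i = w[i] :=
  ⟨fun h i hi => h ⟨i, hi⟩, fun h i => h i i.2⟩

@[simp] lemma mem_cylinder_nil (x : ℕ → B) : x ∈ cylinder ([] : List B) := by
  simp [mem_cylinder_iff]

lemma mem_cylinder_cons {a : B} {w : List B} {x : ℕ → B} :
    x ∈ cylinder (a :: w) ↔ x 0 = a ∧ shift x ∈ cylinder w := by
  simp only [mem_cylinder_iff]
  constructor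
  · intro h
    exact ⟨h 0 (by simp), fun i hi => h (i + 1) (by simpa using hi)⟩
  · rintro ⟨h0, h⟩ (_ | i) hi
    · exact h0
    · exact h i (by simpa using hi)

lemma mem_cylinder_append {u v : List B} {x : ℕ → B} :
    x ∈ cylinder (u ++ v) ↔ x ∈ cylinder u ∧ shift^[u.length] x ∈ cylinder v := by
  induction u generalizing x with
  | nil => simp
  | cons a u ih =>
    simp only [List.cons_append, mem_cylinder_cons, ih, List.length_cons, Function.iterate_succ,
      Function.comp_apply, and_assoc]

lemma mem_cylinder_of_isPrefix {u w : List B} {x : ℕ → B} (h : u <+: w) (hx : x ∈ cylinder w) :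
    x ∈ cylinder u := by
  obtain ⟨t, rfl⟩ := h
  exact (mem_cylinder_append.1 hx).1

lemma prefix_of_mem_cylinder {u w : List B} {x : ℕ → B} (hu : x ∈ cylinder u)
    (hw : x ∈ cylinder w) (h : u.length ≤ w.length) : u <+: w := by
  rw [List.prefix_iff_eq_take]
  refine List.ext_getElem (by simpa using h) fun i h1 h2 => ?_
  rw [List.getElem_take, ← mem_cylinder_iff.1 hu i h1, ← mem_cylinder_iff.1 hw i (by omega)]

@[simp] lemma length_prefixWord (x : ℕ → B) (n : ℕ) : (prefixWord x n).length = n := by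
  simp [prefixWord]

lemma mem_cylinder_prefixWord_iff {x y : ℕ → B} {n : ℕ} :
    y ∈ cylinder (prefixWord x n) ↔ ∀ i < n, y i = x i := by
  simp [mem_cylinder_iff, prefixWord]

lemma mem_cylinder_prefixWord (x : ℕ → B) (n : ℕ) : x ∈ cylinder (prefixWord x n) :=
  mem_cylinder_prefixWord_iff.2 fun _ _ => rfl

variable {X : Set (ℕ → B)}

lemma coe_subShift (hX : MapsTo shift X X) (x : X) : (subShift X x : ℕ → B) = shift x := by
  simp [subShift, hX x.2]

lemma coe_subShift_iterate (hX : MapsTo shift X X) (n : ℕ) (x : X) :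
    ((subShift X)^[n] x : ℕ → B) = shift^[n] x := by
  induction n generalizing x with
  | zero => rfl
  | succ n ih => rw [Function.iterate_succ_apply, Function.iterate_succ_apply, ih, coe_subShift hX]

lemma prefixWord_mem_language (x : X) (n : ℕ) : prefixWord (x : ℕ → B) n ∈ language X :=
  ⟨x, mem_cylinder_prefixWord _ _, x.2⟩

lemma exists_mem_of_mem_language {w : List B} (h : w ∈ language X) :
    ∃ x : X, (x : ℕ → B) ∈ cylinder w := by
  obtain ⟨x, hx, hX⟩ := h
  exact ⟨⟨x, hX⟩, hx⟩

lemma mem_language {w : List B} (x : X) (h : (x : ℕ → B) ∈ cylinder w) : w ∈ language X :=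
  ⟨x, h, x.2⟩

end Shift

section Birkhoff

variable {Y : Type*} (σ : Y → Y) (f : Y → ℝ)

@[simp] lemma birkhoff_zero (y : Y) : birkhoff σ f 0 y = 0 := by simp [birkhoff]

lemma birkhoff_succ' (n : ℕ) (y : Y) : birkhoff σ f (n + 1) y = f y + birkhoff σ f n (σ y) :=
  birkhoffSum_succ' σ f n y

lemma birkhoff_add (m n : ℕ) (y : Y) :
    birkhoff σ f (m + n) y = birkhoff σ f m y + birkhoff σ f n (σ^[m] y) :=
  birkhoffSum_add σ f m n y

variable {f}

lemma birkhoff_le {C : ℝ} (hC : ∀ y, f y ≤ C) (n : ℕ) (y : Y) : birkhoff σ f n y ≤ C * n := by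
  refine (Finset.sum_le_card_nsmul _ _ C fun i _ => hC _).trans_eq ?_
  simp [mul_comm]

lemma le_birkhoff {c : ℝ} (hc : ∀ y, c ≤ f y) (n : ℕ) (y : Y) : c * n ≤ birkhoff σ f n y := by
  refine Eq.trans_le ?_ (Finset.card_nsmul_le_sum _ _ c fun i _ => hc _)
  simp [mul_comm]

lemma abs_birkhoff_le {C : ℝ} (hC : ∀ y, |f y| ≤ C) (n : ℕ) (y : Y) :
    |birkhoff σ f n y| ≤ C * n := by
  rw [abs_le, ← neg_mul]
  exact ⟨le_birkhoff σ (fun y => (abs_le.1 (hC y)).1) n y,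
    birkhoff_le σ (fun y => (abs_le.1 (hC y)).2) n y⟩

lemma birkhoff_sub_const (θ : ℝ) (n : ℕ) (y : Y) :
    birkhoff σ (fun y => f y - θ) n y = birkhoff σ f n y - n * θ := by
  simp [birkhoff, Finset.sum_sub_distrib]

lemma birkhoff_neg (n : ℕ) (y : Y) : birkhoff σ (fun y => - f y) n y = - birkhoff σ f n y := by
  simp [birkhoff]

end Birkhoff

section Compactness

variable {B : Type} [TopologicalSpace B] {X : Set (ℕ → B)}

lemma mem_of_forall_mem_cylinder (hX : IsClosed X) {x : ℕ → B} {p : ℕ → List B}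
    (hp : ∀ j, p j ∈ language X) (hx : ∀ j, x ∈ cylinder (p j)) (hl : ∀ j, j ≤ (p j).length) :
    x ∈ X := by
  choose y hy using fun j => exists_mem_of_mem_language (hp j)
  refine hX.mem_of_tendsto (b := atTop) (f := fun j => (y j : ℕ → B)) ?_
    (Eventually.of_forall fun j => (y j).2)
  rw [tendsto_pi_nhds]
  intro i
  refine tendsto_const_nhds.congr' ?_
  filter_upwards [eventually_gt_atTop i] with j hj
  have := hl j
  rw [mem_cylinder_iff.1 (hx j) i (by omega), mem_cylinder_iff.1 (hy j) i (by omega)]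

variable [Finite B]

lemma compactSpace_of_isClosed (hX : IsClosed X) : CompactSpace X :=
  isCompact_iff_compactSpace.1 hX.isCompact

lemma exists_abs_le (hX : IsClosed X) {f : X → ℝ} (hf : Continuous f) :
    ∃ C : ℝ, 0 < C ∧ ∀ x, |f x| ≤ C := by
  have := compactSpace_of_isClosed hX
  obtain ⟨C, hC⟩ := isCompact_univ.exists_bound_of_continuousOn hf.continuousOn
  refine ⟨max C 1, by positivity, fun x => (hC x (mem_univ _)).trans (le_max_left _ _)⟩

lemma exists_pos_le (hX : IsClosed X) {f : X → ℝ} (hf : Continuous f) (hpos : ∀ x, 0 < f x) :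
    ∃ c : ℝ, 0 < c ∧ ∀ x, c ≤ f x := by
  have := compactSpace_of_isClosed hX
  rcases isEmpty_or_nonempty X with h | h
  · exact ⟨1, one_pos, fun x => isEmptyElim x⟩
  · obtain ⟨x, -, hx⟩ := isCompact_univ.exists_isMinOn univ_nonempty hf.continuousOn
    exact ⟨f x, hpos x, fun y => hx (mem_univ y)⟩

variable [DiscreteTopology B]

/-- A continuous function on a subshift is uniformly close to depending on finitely many
coordinates. -/
lemma exists_window (hX : IsClosed X) {f : X → ℝ} (hf : Continuous f) {ε : ℝ} (hε : 0 < ε) :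
    ∃ m : ℕ, ∀ x y : X, (∀ i < m, (x : ℕ → B) i = (y : ℕ → B) i) → |f x - f y| ≤ ε := by
  have := compactSpace_of_isClosed hX
  let _ : MetricSpace (ℕ → B) := PiNat.metricSpace
  obtain ⟨δ, hδ, h⟩ := Metric.uniformContinuous_iff.1
    (CompactSpace.uniformContinuous_of_continuous hf) ε hε
  obtain ⟨m, hm⟩ := exists_pow_lt_of_lt_one hδ (by norm_num : (1 / 2 : ℝ) < 1)
  refine ⟨m, fun x y hxy => (h (lt_of_le_of_lt ?_ hm)).le⟩
  exact PiNat.mem_cylinder_iff_dist_le.1 fun i hi => hxy i hi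

end Compactness

section EditBirkhoff

variable {B : Type}

/-- The sum of `h` over the windows of length `m` (shorter at the end) of a word. -/
def windowSum (h : List B → ℝ) (m : ℕ) : List B → ℝ
  | [] => 0
  | a :: l => h ((a :: l).take m) + windowSum h m l

lemma abs_windowSum_append_sub_le {h : List B → ℝ} {C : ℝ} (hC : ∀ l, |h l| ≤ C) (m : ℕ)
    (u l l' : List B) : |windowSum h m (u ++ l) - windowSum h m (u ++ l')| ≤
      |windowSum h m l - windowSum h m l'| + 2 * C * min m u.length := by
  induction u with
  | nil => simp
  | cons a u ih =>
    simp only [List.cons_append, windowSum, List.length_cons]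
    have tri := abs_add_le (h ((a :: (u ++ l)).take m) - h ((a :: (u ++ l')).take m))
      (windowSum h m (u ++ l) - windowSum h m (u ++ l'))
    rw [sub_add_sub_comm] at tri
    rcases le_or_gt m u.length with hm | hm
    · have e : (a :: (u ++ l)).take m = (a :: (u ++ l')).take m := by
        rw [← List.cons_append, ← List.cons_append, List.take_append_of_le_length (by simp; omega),
          List.take_append_of_le_length (by simp; omega)]
      rw [e, sub_self, abs_zero] at tri
      have e2 : min m (u.length + 1) = min m u.length := by omega
      rw [e, e2]
      linarith
    · have h1 := abs_sub (h ((a :: (u ++ l)).take m)) (h ((a :: (u ++ l')).take m))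
      have h2 := hC ((a :: (u ++ l)).take m)
      have h3 := hC ((a :: (u ++ l')).take m)
      rw [min_eq_right (by omega)] at ih ⊢
      push_cast
      linarith

lemma EditStep.abs_windowSum_sub_le {h : List B → ℝ} {C : ℝ} (hC : ∀ l, |h l| ≤ C) (m : ℕ)
    {v w : List B} (hvw : EditStep v w) :
    |windowSum h m v - windowSum h m w| ≤ 2 * C * (m + 1) := by
  have hC0 : 0 ≤ C := (abs_nonneg _).trans (hC [])
  have main : ∀ u l l' : List B, |windowSum h m l - windowSum h m l'| ≤ 2 * C →
      |windowSum h m (u ++ l) - windowSum h m (u ++ l')| ≤ 2 * C * (m + 1) := by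
    intro u l l' hl
    have h1 := abs_windowSum_append_sub_le hC m u l l'
    have h2 : ((min m u.length : ℕ) : ℝ) ≤ m := by exact_mod_cast min_le_left _ _
    nlinarith
  rcases hvw with ⟨u₁, u₂, a, a', rfl, rfl⟩ | ⟨u₁, u₂, a, rfl, rfl⟩ | ⟨u₁, u₂, a, rfl, rfl⟩ <;>
    simp only [List.append_assoc, List.singleton_append] <;> apply main <;> simp only [windowSum]
  · rw [add_sub_add_right_eq_sub]
    have := abs_sub (h ((a :: u₂).take m)) (h ((a' :: u₂).take m))
    linarith [hC ((a :: u₂).take m), hC ((a' :: u₂).take m)]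
  · rw [sub_add_cancel_right, abs_neg]
    linarith [hC ((a :: u₂).take m)]
  · rw [add_sub_cancel_right]
    linarith [hC ((a :: u₂).take m)]

variable {X : Set (ℕ → B)}

lemma abs_windowSum_sub_birkhoff_le (hX : MapsTo shift X X) {f : X → ℝ} {h : List B → ℝ} {C ε : ℝ}
    {m : ℕ} (hε : 0 ≤ ε) (hC : ∀ l, |h l| ≤ C) (hfC : ∀ x, |f x| ≤ C)
    (hm : ∀ (x : X) (l : List B), l.length = m → (x : ℕ → B) ∈ cylinder l → |h l - f x| ≤ ε)
    (w : List B) (x : X) (hx : (x : ℕ → B) ∈ cylinder w) :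
    |windowSum h m w - birkhoff (subShift X) f w.length x| ≤
      ε * w.length + 2 * C * min m w.length := by
  induction w generalizing x with
  | nil => simp [windowSum]
  | cons a w ih =>
    have hx' : (subShift X x : ℕ → B) ∈ cylinder w := by
      rw [coe_subShift hX]
      exact (mem_cylinder_cons.1 hx).2
    have ih' := ih _ hx'
    simp only [windowSum, List.length_cons, birkhoff_succ']
    have tri := abs_add_le (h ((a :: w).take m) - f x)
      (windowSum h m w - birkhoff (subShift X) f w.length (subShift X x))
    rw [sub_add_sub_comm] at tri
    rcases le_or_gt m w.length with hmw | hmw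
    · have h1 := hm x ((a :: w).take m) (by simp; omega)
        (mem_cylinder_of_isPrefix ⟨_, List.take_append_drop _ _⟩ hx)
      rw [min_eq_left (by omega)] at ih' ⊢
      push_cast
      linarith
    · have h1 := abs_sub (h ((a :: w).take m)) (f x)
      have h2 := hC ((a :: w).take m)
      have h3 := hfC x
      rw [min_eq_right (by omega)] at ih' ⊢
      push_cast
      linarith

variable [Finite B] [TopologicalSpace B] [DiscreteTopology B]

/-- Birkhoff sums along two words differ sublinearly, up to a multiple of the edit distance. -/
theorem exists_abs_birkhoff_sub_le (hXcl : IsClosed X) (hX : MapsTo shift X X) {f : X → ℝ}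
    (hf : Continuous f) {ε : ℝ} (hε : 0 < ε) :
    ∃ K : ℝ, 0 < K ∧ ∀ (v w : List B) (x y : X),
      (x : ℕ → B) ∈ cylinder v → (y : ℕ → B) ∈ cylinder w →
      |birkhoff (subShift X) f v.length x - birkhoff (subShift X) f w.length y| ≤
        ε * (v.length + w.length) + K * (1 + editDist v w) := by
  obtain ⟨C, hC0, hC⟩ := exists_abs_le hXcl hf
  obtain ⟨m, hm⟩ := exists_window hXcl hf hε
  set h : List B → ℝ := fun l =>
    if hl : ∃ x : X, (x : ℕ → B) ∈ cylinder l then f hl.choose else 0 with hh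
  have hhC : ∀ l, |h l| ≤ C := by
    intro l
    by_cases hl : ∃ x : X, (x : ℕ → B) ∈ cylinder l
    · simp only [hh, dif_pos hl, hC]
    · simp only [hh, dif_neg hl, abs_zero, hC0.le]
  have hhm : ∀ (x : X) (l : List B), l.length = m → (x : ℕ → B) ∈ cylinder l →
      |h l - f x| ≤ ε := by
    intro x l hl hx
    have hl' : ∃ x : X, (x : ℕ → B) ∈ cylinder l := ⟨x, hx⟩
    simp only [hh, dif_pos hl']
    refine hm _ _ fun i hi => ?_
    rw [mem_cylinder_iff.1 hl'.choose_spec i (by omega), mem_cylinder_iff.1 hx i (by omega)]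
  refine ⟨4 * C * (m + 1), by positivity, fun v w x y hx hy => ?_⟩
  have h1 := abs_windowSum_sub_birkhoff_le hX hε.le hhC hC hhm v x hx
  have h2 := abs_windowSum_sub_birkhoff_le hX hε.le hhC hC hhm w y hy
  have h3 := abs_sub_le_editDist (fun v w hvw => EditStep.abs_windowSum_sub_le hhC m hvw) v w
  have h4 : 2 * C * ((min m v.length : ℕ) : ℝ) ≤ 2 * C * m := by
    gcongr
    exact min_le_left _ _
  have h5 : 2 * C * ((min m w.length : ℕ) : ℝ) ≤ 2 * C * m := by
    gcongr
    exact min_le_left _ _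
  rw [abs_le] at *
  constructor <;> nlinarith [h1.1, h1.2, h2.1, h2.2, h3.1, h3.2]

end EditBirkhoff

section SupSum

variable {B : Type} {X : Set (ℕ → B)} {φ : X → ℝ}

lemma editDist_self (v : List B) : editDist v v = 0 :=
  Nat.sInf_eq_zero.2 (Or.inl ⟨fun _ => v, rfl, rfl, by simp⟩)

/-- The supremum of the Birkhoff sums of `φ` over the cylinder of `w`. -/
noncomputable def supSum (X : Set (ℕ → B)) (φ : X → ℝ) (w : List B) : ℝ :=
  sSup (birkhoff (subShift X) φ w.length '' (Subtype.val ⁻¹' cylinder w))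

lemma birkhoff_le_supSum {C : ℝ} (hC : ∀ x, φ x ≤ C) {w : List B} {x : X}
    (hx : (x : ℕ → B) ∈ cylinder w) : birkhoff (subShift X) φ w.length x ≤ supSum X φ w := by
  refine le_csSup ⟨C * w.length, ?_⟩ ⟨x, hx, rfl⟩
  rintro _ ⟨y, -, rfl⟩
  exact birkhoff_le _ hC _ _

lemma supSum_le {w : List B} (hw : w ∈ language X) {M : ℝ}
    (h : ∀ x : X, (x : ℕ → B) ∈ cylinder w → birkhoff (subShift X) φ w.length x ≤ M) :
    supSum X φ w ≤ M := by
  obtain ⟨x, hx⟩ := exists_mem_of_mem_language hw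
  refine csSup_le ⟨_, x, hx, rfl⟩ ?_
  rintro _ ⟨y, hy, rfl⟩
  exact h y hy

lemma supSum_append_le (hX : MapsTo shift X X) {C : ℝ} (hC : ∀ x, φ x ≤ C) {u v : List B}
    (h : u ++ v ∈ language X) : supSum X φ (u ++ v) ≤ supSum X φ u + supSum X φ v := by
  refine supSum_le h fun x hx => ?_
  obtain ⟨hu, hv⟩ := mem_cylinder_append.1 hx
  rw [← coe_subShift_iterate hX] at hv
  rw [List.length_append, birkhoff_add]
  exact add_le_add (birkhoff_le_supSum hC hu) (birkhoff_le_supSum hC hv)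

lemma supSum_le_mul_length {C : ℝ} (hC : ∀ x, φ x ≤ C) {w : List B} (h : w ∈ language X) :
    supSum X φ w ≤ C * w.length :=
  supSum_le h fun x _ => birkhoff_le _ hC _ x

lemma mul_length_le_supSum {C c : ℝ} (hC : ∀ x, φ x ≤ C) (hc : ∀ x, c ≤ φ x) {w : List B}
    (h : w ∈ language X) : c * w.length ≤ supSum X φ w := by
  obtain ⟨x, hx⟩ := exists_mem_of_mem_language h
  exact (le_birkhoff _ hc _ x).trans (birkhoff_le_supSum hC hx)

lemma right_mem_language (hX : MapsTo shift X X) {u v : List B} (h : u ++ v ∈ language X) :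
    v ∈ language X := by
  obtain ⟨x, hx⟩ := exists_mem_of_mem_language h
  have := (mem_cylinder_append.1 hx).2
  rw [← coe_subShift_iterate hX] at this
  exact mem_language _ this

lemma left_mem_language {u v : List B} (h : u ++ v ∈ language X) : u ∈ language X := by
  obtain ⟨x, hx⟩ := exists_mem_of_mem_language h
  exact mem_language _ (mem_cylinder_append.1 hx).1

lemma supSum_append_le_length (hX : MapsTo shift X X) {C : ℝ} (hC : ∀ x, φ x ≤ C) {u v : List B}
    (h : u ++ v ∈ language X) : supSum X φ (u ++ v) ≤ supSum X φ u + C * v.length :=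
  (supSum_append_le hX hC h).trans
    (add_le_add_right (supSum_le_mul_length hC (right_mem_language hX h)) _)

variable [Finite B] [TopologicalSpace B] [DiscreteTopology B]

lemma eventually_abs_birkhoff_sub_le (hXcl : IsClosed X) (hX : MapsTo shift X X) {f : X → ℝ}
    (hf : Continuous f) {g : ℕ → ℕ} (hg : MistakeFun g) {ε : ℝ} (hε : 0 < ε) :
    ∀ᶠ n : ℕ in atTop, ∀ (v w : List B) (x y : X),
      (x : ℕ → B) ∈ cylinder v → (y : ℕ → B) ∈ cylinder w → w.length ≤ n → editDist v w ≤ g n →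
      |birkhoff (subShift X) f v.length x - birkhoff (subShift X) f w.length y| ≤ ε * n := by
  obtain ⟨K, hK, h⟩ := exists_abs_birkhoff_sub_le hXcl hX hf (by positivity : 0 < ε / 8)
  have hK' : ∀ᶠ n : ℕ in atTop, K ≤ ε / 8 * n :=
    (tendsto_natCast_atTop_atTop.const_mul_atTop (by positivity : 0 < ε / 8)).eventually_ge_atTop K
  filter_upwards [hg.eventually_le one_pos, hg.eventually_le (by positivity : 0 < ε / (4 * K)), hK']
    with n h1 h2 h3 v w x y hx hy hw hd
  have h4 := h v w x y hx hy
  have h5 := (abs_le.1 (abs_length_sub_le_editDist v w)).2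
  have h6 : (editDist v w : ℝ) ≤ g n := by exact_mod_cast hd
  have h7 : (w.length : ℝ) ≤ n := by exact_mod_cast hw
  have h8 : K * (editDist v w : ℝ) ≤ ε / 4 * n := by
    calc K * (editDist v w : ℝ) ≤ K * (ε / (4 * K) * n) := by gcongr; linarith
      _ = ε / 4 * n := by field_simp
  nlinarith

end SupSum

section Metric

variable {B : Type} {X : Set (ℕ → B)} {φ : X → ℝ}

lemma apply_wedge_ne {x y : ℕ → B} (h : x ≠ y) : x (wedge x y) ≠ y (wedge x y) :=
  Nat.sInf_mem (s := {n | x n ≠ y n}) (Function.ne_iff.1 h)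

lemma apply_eq_of_lt_wedge {x y : ℕ → B} {i : ℕ} (h : i < wedge x y) : x i = y i := by
  simpa using Nat.notMem_of_lt_sInf h

lemma length_le_wedge {x y : ℕ → B} (h : x ≠ y) {w : List B} (hx : x ∈ cylinder w)
    (hy : y ∈ cylinder w) : w.length ≤ wedge x y := by
  by_contra! hlt
  exact apply_wedge_ne h ((mem_cylinder_iff.1 hx _ hlt).trans (mem_cylinder_iff.1 hy _ hlt).symm)

lemma dphi_of_ne {x y : X} (h : x ≠ y) :
    dphi X φ x y = Real.exp (-supSum X φ (prefixWord x (wedge (x : ℕ → B) y))) := by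
  have : {z : X | ∀ i < wedge x.val y.val, z.val i = x.val i} =
      Subtype.val ⁻¹' cylinder (prefixWord x (wedge (x : ℕ → B) y)) := by
    ext z
    exact mem_cylinder_prefixWord_iff.symm
  rw [dphi, if_neg h, this, supSum, length_prefixWord]

lemma dphi_le_exp_length {C c : ℝ} (hC : ∀ x, φ x ≤ C) (hc0 : 0 < c) (hc : ∀ x, c ≤ φ x)
    {w : List B} {x y : X} (hx : (x : ℕ → B) ∈ cylinder w) (hy : (y : ℕ → B) ∈ cylinder w) :
    dphi X φ x y ≤ Real.exp (-(c * w.length)) := by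
  by_cases h : x = y
  · rw [dphi, if_pos h]
    positivity
  · rw [dphi_of_ne h, Real.exp_le_exp, neg_le_neg_iff]
    refine le_trans ?_ (mul_length_le_supSum hC hc (prefixWord_mem_language x _))
    rw [length_prefixWord]
    have := length_le_wedge (fun e => h (Subtype.ext e)) hx hy
    gcongr

lemma ediam_le {Y : Type*} {d : Y → Y → ℝ} {U : Set Y} {r : ℝ}
    (h : ∀ x ∈ U, ∀ y ∈ U, d x y ≤ r) : ediam d U ≤ ENNReal.ofReal r :=
  iSup₂_le fun x hx => iSup₂_le fun y hy => ENNReal.ofReal_le_ofReal (h x hx y hy)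

lemma le_ediam {Y : Type*} {d : Y → Y → ℝ} {U : Set Y} {x y : Y} (hx : x ∈ U) (hy : y ∈ U) :
    ENNReal.ofReal (d x y) ≤ ediam d U :=
  le_trans (le_iSup₂_of_le (f := fun y (_ : y ∈ U) => ENNReal.ofReal (d x y)) y hy le_rfl)
    (le_iSup₂_of_le (f := fun x (_ : x ∈ U) => ⨆ y ∈ U, ENNReal.ofReal (d x y)) x hx le_rfl)

lemma hMeasAux_le_tsum {Y ι : Type*} [Countable ι] {d : Y → Y → ℝ} {s : ℝ} {ε : ℝ≥0∞} {Z : Set Y}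
    (U : ι → Set Y) (hZ : Z ⊆ ⋃ i, U i) (hU : ∀ i, ediam d (U i) ≤ ε) :
    hMeasAux d s ε Z ≤ ∑' i, ediam d (U i) ^ s := by
  have := Encodable.ofCountable ι
  unfold hMeasAux
  refine (iInf_le _ (fun n => ⋃ i ∈ Encodable.decode₂ ι n, U i)).trans ?_
  refine (iInf_le _ ?_).trans ((iInf_le _ ?_).trans ?_)
  · rwa [Encodable.iUnion_decode₂]
  · intro n
    refine Encodable.iUnion_decode₂_cases (C := fun V => ediam d V ≤ ε) ?_ hU
    simp [ediam]
  · rw [tsum_iUnion_decode₂ (fun V => ⨆ (_ : V.Nonempty), ediam d V ^ s) (by simp)]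
    exact ENNReal.tsum_le_tsum fun i => iSup_le fun _ => le_rfl

lemma hMeas_anti_zero {Y : Type*} {d : Y → Y → ℝ} {s t : ℝ} {Z : Set Y} (hst : s ≤ t)
    (h : hMeas d s Z = 0) : hMeasAux d t 1 Z = 0 := by
  have h1 : hMeasAux d s 1 Z = 0 := by
    refine le_antisymm (le_trans ?_ h.le) zero_le
    exact le_iSup₂_of_le (f := fun ε (_ : 0 < ε) => hMeasAux d s ε Z) 1 one_pos le_rfl
  refine le_antisymm (le_trans ?_ h1.le) zero_le
  refine iInf_mono fun C => iInf_mono fun _ => iInf_mono fun hC => ?_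
  refine ENNReal.tsum_le_tsum fun n => iSup_mono fun _ => ?_
  exact ENNReal.rpow_le_rpow_of_exponent_ge (hC n) hst

lemma hMeas_mono {Y : Type*} {d : Y → Y → ℝ} {s : ℝ} {Z W : Set Y} (h : Z ⊆ W) :
    hMeas d s Z ≤ hMeas d s W :=
  iSup₂_mono fun _ _ => iInf_mono fun _ => iInf_mono' fun hW => ⟨h.trans hW, le_rfl⟩

lemma bddBelow_hdim {Y : Type*} (d : Y → Y → ℝ) (Z : Set Y) :
    BddBelow {s : ℝ | 0 ≤ s ∧ hMeas d s Z = 0} := ⟨0, fun _ h => h.1⟩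

variable [Fintype B]

lemma exists_hMeas_univ_eq_zero {C c : ℝ} (hC : ∀ x, φ x ≤ C) (hc0 : 0 < c)
    (hc : ∀ x, c ≤ φ x) : ∃ s, 0 ≤ s ∧ hMeas (dphi X φ) s univ = 0 := by
  set b : ℝ := Fintype.card B + 1 with hb
  have hb1 : 1 ≤ b := by rw [hb]; linarith [Nat.cast_nonneg (α := ℝ) (Fintype.card B)]
  have hs0 : 0 ≤ (Real.log b + 1) / c := by have := Real.log_nonneg hb1; positivity
  refine ⟨(Real.log b + 1) / c, hs0, ?_⟩
  set s := (Real.log b + 1) / c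
  simp only [hMeas, ENNReal.iSup_eq_zero]
  intro ε hε
  have lim : ∀ a : ℝ, 0 < a → Tendsto (fun n : ℕ => ENNReal.ofReal (Real.exp (-(a * n)))) atTop
      (𝓝 0) := by
    intro a ha
    rw [← ENNReal.ofReal_zero]
    refine ENNReal.tendsto_ofReal (Real.tendsto_exp_neg_atTop_nhds_zero.comp ?_)
    exact tendsto_natCast_atTop_atTop.const_mul_atTop ha
  refine le_antisymm (ge_of_tendsto (lim 1 one_pos) ?_) zero_le
  filter_upwards [(lim c hc0).eventually_le_const hε] with n hn
  have hU : ∀ w : Fin n → B, ediam (dphi X φ) (Subtype.val ⁻¹' cylinder (List.ofFn w)) ≤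
      ENNReal.ofReal (Real.exp (-(c * n))) := by
    intro w
    refine ediam_le fun x hx y hy => ?_
    simpa using dphi_le_exp_length hC hc0 hc hx hy
  refine (hMeasAux_le_tsum (fun w : Fin n → B => Subtype.val ⁻¹' cylinder (List.ofFn w)) ?_
    fun w => (hU w).trans hn).trans ?_
  · intro x _
    exact mem_iUnion.2 ⟨fun i => (x : ℕ → B) i, mem_cylinder_prefixWord x.1 n⟩
  · rw [tsum_fintype]
    refine (Finset.sum_le_card_nsmul _ _ _ fun w _ => ENNReal.rpow_le_rpow (hU w) hs0).trans ?_
    rw [ENNReal.ofReal_rpow_of_nonneg (Real.exp_pos _).le hs0, ← ENNReal.ofReal_nsmul,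
      ← Real.exp_mul]
    refine ENNReal.ofReal_le_ofReal ?_
    have e : -(c * (n : ℝ)) * s = -(n * Real.log b) + -(1 * n) := by
      simp only [s]
      field_simp
      ring
    rw [e, Real.exp_add, Real.exp_neg, Real.exp_nat_mul, Real.exp_log (by linarith), nsmul_eq_mul,
      ← mul_assoc]
    refine mul_le_of_le_one_left (Real.exp_pos _).le ?_
    rw [← div_eq_mul_inv]
    refine div_le_one_of_le₀ ?_ (by positivity)
    simp only [Finset.card_univ, Fintype.card_pi, Finset.prod_const, Fintype.card_fin]
    push_cast
    gcongr
    linarith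

end Metric

section Dimension

variable {B : Type} {X : Set (ℕ → B)} {φ : X → ℝ}

lemma hMeasAux_dphi_ne_zero [Nonempty X] {C c : ℝ} (hC : ∀ x, φ x ≤ C) (hc0 : 0 < c)
    (hc : ∀ x, c ≤ φ x) {s : ℝ} (hs : 0 < s) {c₁ : ℝ} (hc₁ : 0 < c₁) {Z : Set X}
    (h : ∀ w : ℕ → List B, (∀ n, w n ∈ language X) →
      ∑' n, ENNReal.ofReal (Real.exp (-(s * supSum X φ (w n)))) < ENNReal.ofReal c₁ →
      ∃ x ∈ Z, ∀ n, (x : ℕ → B) ∉ cylinder (w n)) :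
    hMeasAux (dphi X φ) s 1 Z ≠ 0 := by
  intro h0
  have hpos : (0 : ℝ≥0∞) < ENNReal.ofReal (c₁ / 2) := ENNReal.ofReal_pos.2 (half_pos hc₁)
  have h1 : hMeasAux (dphi X φ) s 1 Z < ENNReal.ofReal (c₁ / 2) := h0 ▸ hpos
  simp only [hMeasAux, iInf_lt_iff] at h1
  obtain ⟨U, hZ, -, hU⟩ := h1
  obtain ⟨δ, hδ, hδsum⟩ := ENNReal.exists_pos_sum_of_countable hpos.ne' ℕ
  have key : ∀ n, ∃ w ∈ language X, U n ⊆ Subtype.val ⁻¹' cylinder w ∧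
      ENNReal.ofReal (Real.exp (-(s * supSum X φ w))) ≤
        (⨆ (_ : (U n).Nonempty), ediam (dphi X φ) (U n) ^ s) + δ n := by
    intro n
    by_cases hsub : (U n).Subsingleton
    · obtain ⟨x, hx⟩ : ∃ x, U n ⊆ {x} := by
        obtain he | ⟨x, hx⟩ := hsub.eq_empty_or_singleton
        · exact ⟨Classical.arbitrary X, he ▸ empty_subset _⟩
        · exact ⟨x, hx.le⟩
      have lim : Tendsto (fun N : ℕ => Real.exp (-(s * c * N))) atTop (𝓝 0) :=
        Real.tendsto_exp_neg_atTop_nhds_zero.comp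
          (tendsto_natCast_atTop_atTop.const_mul_atTop (mul_pos hs hc0))
      obtain ⟨N, hN⟩ := (lim.eventually_le_const (NNReal.coe_pos.2 (hδ n))).exists
      refine ⟨prefixWord x N, prefixWord_mem_language x N, fun y hy => ?_, ?_⟩
      · rw [hx hy]
        exact mem_cylinder_prefixWord _ _
      · refine le_trans ?_ le_add_self
        rw [← ENNReal.ofReal_coe_nnreal]
        refine ENNReal.ofReal_le_ofReal (le_trans ?_ hN)
        have := mul_length_le_supSum hC hc (prefixWord_mem_language x N)
        rw [length_prefixWord] at this
        rw [Real.exp_le_exp, mul_assoc]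
        gcongr
    · have hex : ∃ m, ∃ x ∈ U n, ∃ y ∈ U n, x ≠ y ∧ wedge (x : ℕ → B) y = m := by
        rw [not_subsingleton_iff] at hsub
        obtain ⟨x, hx, y, hy, hxy⟩ := hsub
        exact ⟨_, x, hx, y, hy, hxy, rfl⟩
      obtain ⟨x, hx, y, hy, hxy, hm⟩ := Nat.find_spec hex
      refine ⟨prefixWord x (wedge (x : ℕ → B) y), prefixWord_mem_language x _, fun z hz => ?_, ?_⟩
      · refine mem_cylinder_prefixWord_iff.2 fun i hi => ?_
        by_cases hxz : x = z
        · rw [hxz]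
        · refine (apply_eq_of_lt_wedge (hi.trans_le ?_)).symm
          rw [hm]
          exact Nat.find_min' hex ⟨x, hx, z, hz, hxz, rfl⟩
      · refine le_trans ?_ le_self_add
        rw [iSup_pos ⟨x, hx⟩]
        refine le_trans ?_ (ENNReal.rpow_le_rpow (le_ediam hx hy) hs.le)
        rw [dphi_of_ne hxy, ENNReal.ofReal_rpow_of_nonneg (Real.exp_pos _).le hs.le, ← Real.exp_mul]
        exact (congrArg (fun t => ENNReal.ofReal (Real.exp t)) (by ring)).le
  choose w hw hUw hle using key
  obtain ⟨x, hx, hxn⟩ := h w hw <| by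
    refine (ENNReal.tsum_le_tsum hle).trans_lt ?_
    rw [ENNReal.tsum_add, ← add_halves c₁, ENNReal.ofReal_add (half_pos hc₁).le (half_pos hc₁).le]
    exact ENNReal.add_lt_add hU hδsum
  obtain ⟨n, hn⟩ := mem_iUnion.1 (hZ hx)
  exact hxn n (hUw n hn)

variable [Fintype B]

/-- The words of length `n` in the language of `X`. -/
noncomputable def wordsOfLength (X : Set (ℕ → B)) (n : ℕ) : Finset (List B) :=
  (List.finite_length_eq B n).toFinset.filter (· ∈ language X)

lemma mem_wordsOfLength {n : ℕ} {w : List B} :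
    w ∈ wordsOfLength X n ↔ w.length = n ∧ w ∈ language X := by
  simp [wordsOfLength]

variable [TopologicalSpace B] [DiscreteTopology B]

lemma eventually_ediam_cylinder_le (hXcl : IsClosed X) (hX : MapsTo shift X X)
    (hφ : Continuous φ) (hφpos : ∀ x, 0 < φ x) {C : ℝ} (hC : ∀ x, φ x ≤ C) {ε : ℝ} (hε : 0 < ε) :
    ∀ᶠ n : ℕ in atTop, ∀ w ∈ wordsOfLength X n,
      ediam (dphi X φ) (Subtype.val ⁻¹' cylinder w) ≤
        ENNReal.ofReal (Real.exp (-supSum X φ w + ε * n)) := by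
  have hg : MistakeFun fun _ => 0 := ⟨monotone_const, by simp⟩
  filter_upwards [eventually_abs_birkhoff_sub_le hXcl hX hφ hg hε] with n hn w hw
  obtain ⟨hwn, hwX⟩ := mem_wordsOfLength.1 hw
  refine ediam_le fun x hx y hy => ?_
  by_cases hxy : x = y
  · rw [dphi, if_pos hxy]
    positivity
  rw [dphi_of_ne hxy, Real.exp_le_exp]
  have h1 : supSum X φ w ≤ birkhoff (subShift X) φ n x + ε * n := by
    refine supSum_le hwX fun z hz => ?_
    have := (abs_le.1 (hn w w z x hz hx hwn.le (editDist_self w).le)).2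
    rw [hwn] at this ⊢
    linarith
  have h2 := birkhoff_le_supSum hC
    (mem_cylinder_prefixWord (x : ℕ → B) (wedge (x : ℕ → B) y))
  rw [length_prefixWord] at h2
  have h3 : birkhoff (subShift X) φ n x ≤ birkhoff (subShift X) φ (wedge (x : ℕ → B) y) x := by
    obtain ⟨k, hk⟩ := Nat.exists_eq_add_of_le
      (hwn ▸ length_le_wedge (fun e => hxy (Subtype.ext e)) hx hy)
    rw [hk, birkhoff_add]
    have := le_birkhoff (subShift X) (fun y => (hφpos y).le) k ((subShift X)^[n] x)
    linarith
  linarith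

lemma exists_exp_le_sum (hXcl : IsClosed X) (hX : MapsTo shift X X)
    (hφ : Continuous φ) (hφpos : ∀ x, 0 < φ x) {C c : ℝ} (hC : ∀ x, φ x ≤ C) (hc0 : 0 < c)
    (hc : ∀ x, c ≤ φ x) {s : ℝ} (hs : 0 < s) (hsd : s < hdim (dphi X φ) univ) :
    ∃ δ : ℝ, 0 < δ ∧ ∀ᶠ n : ℕ in atTop,
      Real.exp (δ * n) ≤ ∑ w ∈ wordsOfLength X n, Real.exp (-(s * supSum X φ w)) := by
  obtain ⟨t, hst, htd⟩ := exists_between hsd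
  have ht : 0 < t := hs.trans hst
  have hne : hMeas (dphi X φ) t univ ≠ 0 := fun h0 =>
    htd.not_ge (csInf_le (bddBelow_hdim _ _) ⟨ht.le, h0⟩)
  obtain ⟨ε₀, hε₀, hH⟩ : ∃ ε : ℝ≥0∞, 0 < ε ∧ hMeasAux (dphi X φ) t ε univ ≠ 0 := by
    by_contra! h0
    exact hne (by simpa [hMeas] using h0)
  set H := hMeasAux (dphi X φ) t ε₀ univ
  have hH' : 0 < (min H 1).toReal :=
    ENNReal.toReal_pos (by simp [hH]) (min_lt_of_right_lt ENNReal.one_lt_top).ne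
  set δ := (t - s) * c / 4 with hδ
  have hδ0 : 0 < δ := by have := sub_pos.2 hst; positivity
  have lim : ∀ a : ℝ, 0 < a → Tendsto (fun n : ℕ => Real.exp (-(a * n))) atTop (𝓝 0) :=
    fun a ha => Real.tendsto_exp_neg_atTop_nhds_zero.comp
      (tendsto_natCast_atTop_atTop.const_mul_atTop ha)
  have lim' : Tendsto (fun n : ℕ => ENNReal.ofReal (Real.exp (-(c * n)))) atTop (𝓝 0) := by
    simpa using ENNReal.tendsto_ofReal (lim c hc0)
  refine ⟨δ, hδ0, ?_⟩
  filter_upwards [eventually_ediam_cylinder_le hXcl hX hφ hφpos hC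
    (by positivity : 0 < 2 * δ / t), (lim δ hδ0).eventually_le_const hH',
    lim'.eventually_le_const hε₀] with n h1 h2 h3
  have h4 : H ≤ ∑' w : wordsOfLength X n,
      ediam (dphi X φ) (Subtype.val ⁻¹' cylinder (w : List B)) ^ t := by
    refine hMeasAux_le_tsum (fun w : wordsOfLength X n => Subtype.val ⁻¹' cylinder (w : List B))
      (fun x _ => ?_) fun w => ?_
    · exact mem_iUnion.2 ⟨⟨prefixWord x n, mem_wordsOfLength.2
        ⟨length_prefixWord _ _, prefixWord_mem_language x n⟩⟩, mem_cylinder_prefixWord _ _⟩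
    · refine le_trans (ediam_le fun x hx y hy => ?_) h3
      simpa [(mem_wordsOfLength.1 w.2).1] using dphi_le_exp_length hC hc0 hc hx hy
  have h5 : ∀ w ∈ wordsOfLength X n, ediam (dphi X φ) (Subtype.val ⁻¹' cylinder w) ^ t ≤
      ENNReal.ofReal (Real.exp (-(s * supSum X φ w)) * Real.exp (-(2 * δ * n))) := by
    intro w hw
    refine (ENNReal.rpow_le_rpow (h1 w hw) ht.le).trans ?_
    rw [ENNReal.ofReal_rpow_of_nonneg (Real.exp_pos _).le ht.le, ← Real.exp_mul, ← Real.exp_add]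
    refine ENNReal.ofReal_le_ofReal (Real.exp_le_exp.2 ?_)
    obtain ⟨hwn, hwX⟩ := mem_wordsOfLength.1 hw
    have := mul_length_le_supSum hC hc hwX
    rw [hwn] at this
    have h6 := mul_le_mul_of_nonneg_left this (sub_pos.2 hst).le
    have h7 : 2 * δ / t * n * t = 2 * δ * n := by field_simp
    have h8 : 4 * δ = (t - s) * c := by rw [hδ]; ring
    have h9 : (t - s) * (c * n) = 4 * δ * n := by rw [h8]; ring
    rw [add_mul, h7]
    linarith
  rw [tsum_fintype, Finset.sum_coe_sort (wordsOfLength X n)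
    (fun w => ediam (dphi X φ) (Subtype.val ⁻¹' cylinder w) ^ t)] at h4
  have h6 := h4.trans (Finset.sum_le_sum h5)
  rw [← ENNReal.ofReal_sum_of_nonneg (fun _ _ => by positivity), ← Finset.sum_mul] at h6
  have h7 : (min H 1).toReal ≤
      (∑ w ∈ wordsOfLength X n, Real.exp (-(s * supSum X φ w))) * Real.exp (-(2 * δ * n)) :=
    ENNReal.toReal_le_of_le_ofReal (by positivity) ((min_le_left _ _).trans h6)
  have h8 : Real.exp (δ * n) * Real.exp (-(2 * δ * n)) = Real.exp (-(δ * n)) := by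
    rw [← Real.exp_add]
    ring_nf
  exact le_of_mul_le_mul_right (h8.trans_le (h2.trans h7)) (Real.exp_pos _)

end Dimension

section Irregular

variable {Y : Type*} {σ : Y → Y} {f : Y → ℝ} {C : ℝ}

lemma exists_birkhoff_le_of_frequently (hC : ∀ y, |f y| ≤ C) {α α' : ℝ} (hα : α' < α) {x : Y}
    (hx : ∃ᶠ n in atTop, birkAvg σ f n x < α') (l : ℕ) : ∃ y, birkhoff σ f l y ≤ α * l := by
  by_contra! h
  have hl : 0 < l := by
    rcases Nat.eq_zero_or_pos l with rfl | hl
    · have := h x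
      simp [birkhoff] at this
    · exact hl
  have hC0 : 0 ≤ C := (abs_nonneg _).trans (hC x)
  have key : ∀ (n : ℕ) (y : Y), α * n - (|α| + C) * l ≤ birkhoff σ f n y := by
    intro n
    induction n using Nat.strong_induction_on with
    | _ n ih =>
      intro y
      rcases lt_or_ge n l with hn | hn
      · have h1 := (abs_le.1 (abs_birkhoff_le σ hC n y)).1
        have h2 : (n : ℝ) ≤ l := by exact_mod_cast hn.le
        have h3 := le_abs_self α
        have h4 := abs_nonneg α
        have h5 : α * n ≤ |α| * n := by gcongr
        have h6 : (|α| + C) * n ≤ (|α| + C) * l := by gcongr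
        linarith
      · obtain ⟨k, rfl⟩ := Nat.exists_eq_add_of_le hn
        rw [birkhoff_add]
        have h1 := ih k (by omega) (σ^[l] y)
        have h2 := h y
        push_cast
        linarith
  have lim : Tendsto (fun n : ℕ => α - (|α| + C) * l / n) atTop (𝓝 (α - 0)) :=
    tendsto_const_nhds.sub (tendsto_const_div_atTop_nhds_zero_nat _)
  rw [sub_zero] at lim
  have hev := (lim.eventually_const_le hα).and (eventually_gt_atTop 0)
  obtain ⟨n, h1, h2, h3⟩ := (hx.and_eventually hev).exists
  refine h1.not_ge (h2.trans ?_)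
  have h4 : (0 : ℝ) < n := by exact_mod_cast h3
  rw [birkAvg, inv_mul_eq_div, le_div_iff₀ h4]
  refine le_trans (le_of_eq ?_) (key n x)
  field_simp

lemma exists_lt_of_mem_irregular (hC : ∀ y, |f y| ≤ C) {x : Y} (hx : x ∈ irregular σ f) :
    ∃ α β : ℝ, α < β ∧ ∀ l : ℕ, (∃ y, birkhoff σ f l y ≤ α * l) ∧
      ∃ z, β * l ≤ birkhoff σ f l z := by
  have hb : ∀ n, |birkAvg σ f n x| ≤ C := by
    intro n
    have hC0 : 0 ≤ C := (abs_nonneg _).trans (hC x)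
    rw [birkAvg, abs_mul, abs_inv, Nat.abs_cast, inv_mul_eq_div]
    exact div_le_of_le_mul₀ n.cast_nonneg hC0 (abs_birkhoff_le σ hC n x)
  obtain ⟨a, b, hab, h1, h2⟩ : ∃ a b : ℝ, a < b ∧ (∃ᶠ n in atTop, birkAvg σ f n x < a) ∧
      ∃ᶠ n in atTop, b < birkAvg σ f n x := by
    by_contra! H
    refine hx (tendsto_of_no_upcrossings dense_univ (fun a _ b _ hab => ?_) ?_ ?_)
    · rintro ⟨h1, h2⟩
      exact h2 ((H a b hab h1).mono fun n hn => not_lt.2 hn)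
    · exact isBoundedUnder_of ⟨C, fun n => (abs_le.1 (hb n)).2⟩
    · exact isBoundedUnder_of ⟨-C, fun n => (abs_le.1 (hb n)).1⟩
  obtain ⟨α, hα, hαb⟩ := exists_between hab
  obtain ⟨β, hβ, hβb⟩ := exists_between hαb
  refine ⟨α, β, hβ, fun l => ⟨exists_birkhoff_le_of_frequently hC hα h1 l, ?_⟩⟩
  obtain ⟨z, hz⟩ := exists_birkhoff_le_of_frequently (σ := σ) (f := fun y => -f y) (C := C)
    (by simpa using hC) (neg_lt_neg hβb) (x := x)
    (h2.mono fun n hn => by rw [birkAvg, birkhoff_neg, mul_neg]; exact neg_lt_neg hn) l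
  rw [birkhoff_neg] at hz
  exact ⟨z, by linarith⟩

end Irregular

section Blocks

variable {B : Type} {X : Set (ℕ → B)} {φ : X → ℝ}

/-- A finite family of words of `G` whose total weight exceeds `K` times the maximal number
of indices for which the word is a prefix of a given word. -/
structure BlockFamily (X : Set (ℕ → B)) (φ : X → ℝ) (G : Set (List B)) (s K N : ℝ)
    (W : Finset (List B)) (b : List B → List B) : Prop where
  mem : ∀ i ∈ W, b i ∈ G
  card_le : ∀ z, ((W.filter (b · <+: z)).card : ℝ) ≤ N
  le_sum : N * K ≤ ∑ i ∈ W, Real.exp (-(s * supSum X φ (b i)))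

variable [Fintype B] [TopologicalSpace B] [DiscreteTopology B]

lemma exists_blockFamily (hXcl : IsClosed X) (hX : MapsTo shift X X) [Nonempty X]
    (hφ : Continuous φ) {C : ℝ} (hC0 : 0 < C) (hC : ∀ x, φ x ≤ C)
    {G : Set (List B)} (hG : G ⊆ language X) {τ : ℕ}
    (hspec : ∀ v ∈ G, ∀ w ∈ G, ∃ u ∈ language X, u.length ≤ τ ∧ v ++ u ++ w ∈ G)
    (happ : EditApproachable (language X) G) {ψ : X → ℝ} (hψ : Continuous ψ) {C₂ : ℝ}
    (hC₂0 : 0 < C₂) (hC₂ : ∀ x, |ψ x| ≤ C₂) {s δ : ℝ} (hs : 0 < s) (hδ : 0 < δ)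
    (hgrowth : ∀ᶠ n : ℕ in atTop,
      Real.exp (δ * n) ≤ ∑ w ∈ wordsOfLength X n, Real.exp (-(s * supSum X φ w)))
    {α β : ℝ} (hαβ : α < β) (hdev : ∀ l : ℕ, (∃ y, birkhoff (subShift X) ψ l y ≤ α * l) ∧
      ∃ z, β * l ≤ birkhoff (subShift X) ψ l z) (K D : ℝ) :
    ∃ (θ N : ℝ) (W : Finset (List B)) (b₁ b₂ : List B → List B), |θ| ≤ C₂ ∧ 0 < N ∧
      BlockFamily X φ G s K N W b₁ ∧ BlockFamily X φ G s K N W b₂ ∧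
      (∀ i ∈ W, ∀ x : X, (x : ℕ → B) ∈ cylinder (b₁ i) →
        birkhoff (subShift X) (fun y => ψ y - θ) (b₁ i).length x ≤ -D) ∧
      ∀ i ∈ W, ∀ x : X, (x : ℕ → B) ∈ cylinder (b₂ i) →
        D ≤ birkhoff (subShift X) (fun y => ψ y - θ) (b₂ i).length x := by
  obtain ⟨g, hg, happ⟩ := happ
  choose! v hvG hvd using happ
  have hxw : ∀ w ∈ language X, ∃ x : X, (x : ℕ → B) ∈ cylinder w :=
    fun w hw => exists_mem_of_mem_language hw
  choose! xw hxw using hxw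
  obtain ⟨q, hq⟩ := exists_nat_gt ((s * (1 + 3 * C) + 2) / δ)
  have hq0 : (0 : ℝ) < q := lt_trans (by positivity) hq
  have hqδ : s * (1 + 3 * C) + 2 ≤ δ * q := by
    rw [div_lt_iff₀ hδ] at hq
    linarith
  set ε := (β - α) / 28 with hε
  have hε0 : 0 < ε := by have := sub_pos.2 hαβ; positivity
  set t : Finset ℤ := Finset.Icc ⌊-(C₂ * q / ε)⌋ ⌊C₂ * q / ε⌋ with ht
  have htne : t.Nonempty := by
    rw [ht, Finset.nonempty_Icc]
    refine Int.floor_mono ?_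
    have : 0 < C₂ * q / ε := by positivity
    linarith
  have htc : (0 : ℝ) < t.card := by exact_mod_cast htne.card_pos
  have hql : Tendsto (fun l : ℕ => q * l) atTop atTop :=
    tendsto_id.const_mul_atTop' (by exact_mod_cast hq0)
  have hlin : ∀ {e : ℝ}, 0 < e → ∀ c : ℝ, ∀ᶠ l : ℕ in atTop, c ≤ e * l := fun he c =>
    (tendsto_natCast_atTop_atTop.const_mul_atTop he).eventually_ge_atTop c
  have hexp : ∀ᶠ l : ℕ in atTop, t.card * K ≤ Real.exp l :=
    (Real.tendsto_exp_atTop.comp tendsto_natCast_atTop_atTop).eventually_ge_atTop _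
  obtain ⟨l, hgr, hmult, hφv, hψv, hψa, hgn, hgl, hgl', hτ1, hτ2, hD, hK, hl0⟩ :=
    ((hql.eventually hgrowth).and <|
    (hql.eventually (eventually_exists_finset_editDist_prefixes (B := B) hg
      (by positivity : 0 < 1 / (q : ℝ)))).and <|
    (hql.eventually (eventually_abs_birkhoff_sub_le hXcl hX hφ hg
      (by positivity : 0 < 1 / (q : ℝ)))).and <|
    (hql.eventually (eventually_abs_birkhoff_sub_le hXcl hX hψ hg
      (by positivity : 0 < ε / q))).and <|
    (eventually_abs_birkhoff_sub_le hXcl hX hψ hg hε0).and <|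
    (hql.eventually (hg.eventually_le (by positivity : 0 < ε / (C₂ * q)))).and <|
    (hg.eventually_le (by positivity : 0 < ε / C₂)).and <|
    (hg.eventually_le one_pos).and <|
    (hlin hε0 (C₂ * τ)).and <| (hlin one_pos τ).and <|
    (hlin (by positivity : 0 < 7 * ε) D).and <| hexp.and <| eventually_gt_atTop 0).exists
  have hl : (0 : ℝ) < l := by exact_mod_cast hl0
  set n := q * l with hn
  have hnl : (n : ℝ) = q * l := by rw [hn]; push_cast; ring
  have e1 : 1 / (q : ℝ) * n = l := by rw [hnl]; field_simp
  have e2 : ε / q * n = ε * l := by rw [hnl]; field_simp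
  have e3 : C₂ * (ε / (C₂ * q) * n) = ε * l := by rw [hnl]; field_simp
  have e4 : C₂ * (ε / C₂ * l) = ε * l := by field_simp
  rw [e1] at hmult hφv
  rw [e2] at hψv
  rw [one_mul] at hgl' hτ2
  have hgn : C₂ * g n ≤ ε * l := e3 ▸ mul_le_mul_of_nonneg_left hgn hC₂0.le
  have hgl : C₂ * g l ≤ ε * l := e4 ▸ mul_le_mul_of_nonneg_left hgl hC₂0.le
  set S : List B → ℝ := fun w => birkhoff (subShift X) ψ n (xw w)
  have hSb : ∀ w, |S w| ≤ C₂ * n := fun w => abs_birkhoff_le _ hC₂ _ _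
  have hbin : ∀ w ∈ wordsOfLength X n, ⌊S w / (ε * l)⌋ ∈ t := by
    intro w _
    have h1 := abs_le.1 (hSb w)
    have h2 : C₂ * q / ε = C₂ * n / (ε * l) := by rw [hnl]; field_simp
    rw [ht, Finset.mem_Icc, h2, ← neg_div]
    constructor <;> refine Int.floor_mono ?_ <;> gcongr
    exacts [h1.1, h1.2]
  obtain ⟨k, -, hk⟩ := Finset.exists_le_sum_fiber_of_maps_to_of_nsmul_le_sum hbin htne
    (w := fun w => Real.exp (-(s * supSum X φ w))) (b := Real.exp (δ * n) / t.card)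
    (by rw [nsmul_eq_mul, mul_div_cancel₀ _ htc.ne']; exact hgr)
  set W := (wordsOfLength X n).filter fun w => ⌊S w / (ε * l)⌋ = k
  have hWl : ∀ w ∈ W, w.length = n ∧ w ∈ language X := fun w hw =>
    mem_wordsOfLength.1 (Finset.mem_filter.1 hw).1
  have hWne : W.Nonempty := by
    by_contra! h0
    rw [h0, Finset.sum_empty] at hk
    exact hk.not_gt (by positivity)
  obtain ⟨w₀, hw₀⟩ := hWne
  have hSW : ∀ w ∈ W, |S w - S w₀| ≤ ε * l := by
    intro w hw
    have h1 := Int.abs_sub_lt_one_of_floor_eq_floor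
      ((Finset.mem_filter.1 hw).2.trans (Finset.mem_filter.1 hw₀).2.symm)
    rw [← sub_div, abs_div, abs_of_pos (by positivity : 0 < ε * l),
      div_lt_one (by positivity)] at h1
    exact h1.le
  obtain ⟨⟨y, hy⟩, z, hz⟩ := hdev l
  set θ := (S w₀ + l * ((α + β) / 2)) / (n + l) with hθ
  have hnl0 : (0 : ℝ) < n + l := by positivity
  have hθe : (n + l) * θ = S w₀ + l * ((α + β) / 2) := by rw [hθ]; field_simp
  have hθC : |θ| ≤ C₂ := by
    have h1 := abs_le.1 (hSb w₀)
    have h2 := (abs_le.1 (abs_birkhoff_le (subShift X) hC₂ l y)).1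
    have h3 := (abs_le.1 (abs_birkhoff_le (subShift X) hC₂ l z)).2
    have h4 : α * l < β * l := by gcongr
    rw [hθ, abs_div, abs_of_pos hnl0, div_le_iff₀ hnl0, abs_le]
    constructor <;> linarith
  have fam : ∀ a ∈ G, a.length ≤ 2 * l → ∃ b : List B → List B,
      (∀ w ∈ W, ∃ u, u.length ≤ τ ∧ b w = v w ++ u ++ a) ∧
        BlockFamily X φ G s K (Real.exp l) W b := by
    intro a ha hal
    have hu : ∀ w ∈ W, ∃ u, u.length ≤ τ ∧ v w ++ u ++ a ∈ G := fun w hw => by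
      obtain ⟨u, -, h1, h2⟩ := hspec _ (hvG w (hWl w hw).2) a ha
      exact ⟨u, h1, h2⟩
    choose! u hul huG using hu
    refine ⟨fun w => v w ++ u w ++ a, fun w hw => ⟨u w, hul w hw, rfl⟩, huG, fun z => ?_, ?_⟩
    · obtain ⟨F, hF, hFc⟩ := hmult z
      refine le_trans (Nat.cast_le.2 (Finset.card_le_card fun w hw => ?_)) hFc
      obtain ⟨hwW, hwz⟩ := Finset.mem_filter.1 hw
      obtain ⟨h1, h2⟩ := hWl w hwW
      refine hF w (v w) h1 (List.IsPrefix.trans ?_ hwz) (h1 ▸ hvd w h2)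
      rw [List.append_assoc]
      exact List.prefix_append _ _
    · have hsup : ∀ w ∈ W, supSum X φ (v w ++ u w ++ a) ≤ supSum X φ w + (1 + 3 * C) * l := by
        intro w hw
        obtain ⟨h1, h2⟩ := hWl w hw
        have h3 := hG (huG w hw)
        have h4 := supSum_append_le_length hX hC h3
        have h5 := supSum_append_le_length hX hC (left_mem_language h3)
        have h6 : supSum X φ (v w) ≤ supSum X φ w + l := by
          refine supSum_le (hG (hvG w h2)) fun x hx => ?_
          have h7 := (abs_le.1 (hφv (v w) w x (xw w) hx (hxw w h2) h1.le (h1 ▸ hvd w h2))).2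
          have h8 := birkhoff_le_supSum hC (hxw w h2)
          linarith
        have h7 : C * (a.length : ℝ) ≤ C * (2 * l) := by
          gcongr
          exact_mod_cast hal
        have h8 : C * ((u w).length : ℝ) ≤ C * l := by
          gcongr
          exact (hul w hw).trans (Nat.cast_le.1 hτ2)
        linarith
      have h1 : Real.exp (-(s * ((1 + 3 * C) * l))) * (Real.exp (δ * n) / t.card) ≤
          ∑ w ∈ W, Real.exp (-(s * supSum X φ (v w ++ u w ++ a))) := by
        refine (mul_le_mul_of_nonneg_left hk (Real.exp_pos _).le).trans ?_
        rw [Finset.mul_sum]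
        refine Finset.sum_le_sum fun w hw => ?_
        rw [← Real.exp_add, Real.exp_le_exp]
        have := mul_le_mul_of_nonneg_left (hsup w hw) hs.le
        linarith
      refine le_trans ?_ h1
      rw [← mul_div_assoc, le_div_iff₀ htc, ← Real.exp_add]
      have h2 : Real.exp l * Real.exp l ≤ Real.exp (-(s * ((1 + 3 * C) * l)) + δ * n) := by
        rw [← Real.exp_add, Real.exp_le_exp, hnl]
        have := mul_le_mul_of_nonneg_right hqδ hl.le
        linarith
      refine le_trans ?_ h2
      rw [mul_assoc, mul_comm K]
      gcongr
  have dev : ∀ (a : List B) (y : X), editDist a (prefixWord y l) ≤ g l → ∀ w ∈ W, ∀ u,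
      u.length ≤ τ → ∀ x : X, (x : ℕ → B) ∈ cylinder (v w ++ u ++ a) →
      |birkhoff (subShift X) (fun y => ψ y - θ) (v w ++ u ++ a).length x -
        (birkhoff (subShift X) ψ l y - l * ((α + β) / 2))| ≤ 7 * ε * l := by
    intro a y hay w hw u hu x hx
    obtain ⟨hwn, hwX⟩ := hWl w hw
    obtain ⟨hx1, hxa⟩ := mem_cylinder_append.1 hx
    obtain ⟨hxv, -⟩ := mem_cylinder_append.1 hx1
    rw [← coe_subShift_iterate hX] at hxa
    have hvd' : editDist (v w) w ≤ g n := hwn ▸ hvd w hwX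
    have h1 := abs_le.1 (hψv (v w) w x (xw w) hxv (hxw w hwX) hwn.le hvd')
    have h2 := abs_le.1 (hψa a (prefixWord y l) _ y hxa (mem_cylinder_prefixWord _ _)
      (length_prefixWord _ _).le hay)
    have h3 := abs_le.1 (abs_birkhoff_le (subShift X) hC₂ u.length ((subShift X)^[(v w).length] x))
    have h4 := abs_le.1 (hSW w hw)
    have h5 : C₂ * (u.length : ℝ) ≤ ε * l := le_trans (by gcongr) hτ1
    have h6 : |(v w).length - (n : ℝ)| ≤ g n := by
      refine le_trans ?_ (Nat.cast_le.2 hvd')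
      rw [← hwn]
      exact abs_length_sub_le_editDist _ _
    have h7 : |a.length - (l : ℝ)| ≤ g l := by
      refine le_trans ?_ (Nat.cast_le.2 hay)
      simpa using abs_length_sub_le_editDist a (prefixWord y l)
    rw [hwn] at h1
    rw [length_prefixWord] at h2
    have h8 : |((v w ++ u ++ a).length : ℝ) * θ - (n + l) * θ| ≤ 3 * (ε * l) := by
      have h9 : ((v w ++ u ++ a).length : ℝ) * θ - (n + l) * θ =
          ((v w).length - (n : ℝ)) * θ + u.length * θ + (a.length - (l : ℝ)) * θ := by
        simp only [List.length_append]
        push_cast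
        ring
      rw [h9]
      refine (abs_add_three _ _ _).trans ?_
      simp only [abs_mul, Nat.abs_cast]
      have k1 : |(v w).length - (n : ℝ)| * |θ| ≤ g n * C₂ := by gcongr
      have k2 : (u.length : ℝ) * |θ| ≤ u.length * C₂ := by gcongr
      have k3 : |a.length - (l : ℝ)| * |θ| ≤ g l * C₂ := by gcongr
      linarith
    have h8 := abs_le.1 h8
    rw [birkhoff_sub_const, List.length_append, birkhoff_add, List.length_append, birkhoff_add]
    rw [List.length_append, List.length_append, hθe] at h8
    rw [List.length_append] at h2
    simp only [S] at h4 h8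
    rw [abs_le]
    constructor <;> linarith [h1.1, h1.2, h2.1, h2.2, h3.1, h3.2, h4.1, h4.2, h8.1, h8.2]
  have app : ∀ y : X, ∃ a ∈ G, a.length ≤ 2 * l ∧ editDist a (prefixWord y l) ≤ g l := by
    intro y
    have h1 := hvd _ (prefixWord_mem_language y l)
    rw [length_prefixWord] at h1
    refine ⟨_, hvG _ (prefixWord_mem_language y l), ?_, h1⟩
    have h2 := (abs_le.1 (abs_length_sub_le_editDist (v (prefixWord y l)) (prefixWord y l))).2
    rw [length_prefixWord] at h2
    have h3 : (editDist (v (prefixWord y l)) (prefixWord y l) : ℝ) ≤ g l := by exact_mod_cast h1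
    have h4 : ((v (prefixWord y l)).length : ℝ) ≤ 2 * l := by linarith
    exact_mod_cast h4
  obtain ⟨a₁, ha₁, hl₁, hd₁⟩ := app y
  obtain ⟨a₂, ha₂, hl₂, hd₂⟩ := app z
  obtain ⟨b₁, hb₁, hf₁⟩ := fam a₁ ha₁ hl₁
  obtain ⟨b₂, hb₂, hf₂⟩ := fam a₂ ha₂ hl₂
  have h28 : β - α = 28 * ε := by rw [hε]; ring
  have h28' : (β - α) * l = 28 * (ε * l) := by rw [h28]; ring
  refine ⟨θ, Real.exp l, W, b₁, b₂, hθC, Real.exp_pos _, hf₁, hf₂, ?_, ?_⟩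
  · intro w hw x hx
    obtain ⟨u, hu, hb⟩ := hb₁ w hw
    rw [hb] at hx ⊢
    have := (abs_le.1 (dev a₁ y hd₁ w hw u hu x hx)).2
    linarith
  · intro w hw x hx
    obtain ⟨u, hu, hb⟩ := hb₂ w hw
    rw [hb] at hx ⊢
    have := (abs_le.1 (dev a₂ z hd₂ w hw u hu x hx)).1
    linarith

end Blocks

section Descent

variable {B : Type} {X : Set (ℕ → B)} {φ : X → ℝ} {G : Set (List B)} {s C N : ℝ} {τ : ℕ}
  {W : Finset (List B)} {b : List B → List B}

lemma BlockFamily.card_filter_append_le {K : ℝ} (hb : BlockFamily X φ G s K N W b)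
    {u : List B → List B} (hu : ∀ i ∈ W, (u i).length ≤ τ) (z : List B) :
    ((W.filter fun i => u i ++ b i <+: z).card : ℝ) ≤ (τ + 1) * N := by
  rw [Finset.card_eq_sum_card_fiberwise (f := fun i => (u i).length) (t := Finset.range (τ + 1))]
  · push_cast
    refine (Finset.sum_le_card_nsmul _ _ N fun k _ => ?_).trans_eq (by simp)
    refine le_trans (Nat.cast_le.2 (Finset.card_le_card fun i hi => ?_)) (hb.card_le (z.drop k))
    obtain ⟨hi1, hk⟩ := Finset.mem_filter.1 hi
    obtain ⟨hiW, r, hr⟩ := Finset.mem_filter.1 hi1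
    refine Finset.mem_filter.2 ⟨hiW, r, ?_⟩
    rw [← hr, ← hk, List.append_assoc, List.drop_left]
  · intro i hi
    have := hu i (Finset.mem_filter.1 hi).1
    simp only [Finset.coe_range, mem_Iio]
    omega

/-- The total mass of the words `w n` extending `p`, where `w n` has mass `e n`. -/
noncomputable def massBelow (w : ℕ → List B) (e : ℕ → ℝ≥0∞) (p : List B) : ℝ≥0∞ :=
  ∑' n, if p <+: w n then e n else 0

lemma sum_massBelow_append_le {K : ℝ} (hb : BlockFamily X φ G s K N W b)
    {u : List B → List B} (hu : ∀ i ∈ W, (u i).length ≤ τ) (w : ℕ → List B) (e : ℕ → ℝ≥0∞)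
    (p : List B) :
    ∑ i ∈ W, massBelow w e (p ++ u i ++ b i) ≤
      ENNReal.ofReal ((τ + 1) * N) * massBelow w e p := by
  simp only [massBelow]
  rw [← ENNReal.tsum_mul_left,
    ← Summable.tsum_finsetSum (f := fun i n => if p ++ u i ++ b i <+: w n then e n else 0)
      fun _ _ => ENNReal.summable]
  refine ENNReal.tsum_le_tsum fun n => ?_
  by_cases hp : p <+: w n
  · obtain ⟨r, hr⟩ := hp
    rw [if_pos ⟨r, hr⟩, ← Finset.sum_filter, Finset.sum_const, nsmul_eq_mul]
    gcongr
    rw [← ENNReal.ofReal_natCast]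
    refine ENNReal.ofReal_le_ofReal (le_trans (le_of_eq ?_) (hb.card_filter_append_le hu r))
    simp only [← hr, List.append_assoc, List.prefix_append_right_inj]
  · rw [if_neg hp, mul_zero]
    refine (Finset.sum_eq_zero fun i _ => if_neg fun h => hp (List.IsPrefix.trans ?_ h)).le
    rw [List.append_assoc]
    exact List.prefix_append _ _

lemma exists_child (hX : MapsTo shift X X) (hC : ∀ x, φ x ≤ C) (hC0 : 0 ≤ C)
    (hG : G ⊆ language X) (hs : 0 < s)
    (hspec : ∀ v ∈ G, ∀ w ∈ G, ∃ u ∈ language X, u.length ≤ τ ∧ v ++ u ++ w ∈ G) (hN : 0 < N)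
    (hb : BlockFamily X φ G s ((τ + 1) * Real.exp (s * (C * τ))) N W b) (w : ℕ → List B)
    (e : ℕ → ℝ≥0∞) {c : ℝ} (hc : 0 < c) {p : List B} (hp : p ∈ G)
    (hm : massBelow w e p < ENNReal.ofReal (c * Real.exp (-(s * supSum X φ p)))) :
    ∃ i ∈ W, ∃ u, u.length ≤ τ ∧ p ++ u ++ b i ∈ G ∧ massBelow w e (p ++ u ++ b i) <
      ENNReal.ofReal (c * Real.exp (-(s * supSum X φ (p ++ u ++ b i)))) := by
  by_contra! h
  have hu : ∀ i ∈ W, ∃ u : List B, u.length ≤ τ ∧ p ++ u ++ b i ∈ G := fun i hi => by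
    obtain ⟨u, -, h1, h2⟩ := hspec p hp (b i) (hb.mem i hi)
    exact ⟨u, h1, h2⟩
  choose! u hul huG using hu
  have h1 : (τ + 1) * N * (c * Real.exp (-(s * supSum X φ p))) ≤
      ∑ i ∈ W, c * Real.exp (-(s * supSum X φ (p ++ u i ++ b i))) := by
    have h2 : ∀ i ∈ W, c * Real.exp (-(s * supSum X φ p)) * Real.exp (-(s * (C * τ))) *
        Real.exp (-(s * supSum X φ (b i))) ≤
          c * Real.exp (-(s * supSum X φ (p ++ u i ++ b i))) := by
      intro i hi
      have h3 := hG (huG i hi)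
      have h4 := supSum_append_le hX hC h3
      have h5 := supSum_append_le_length hX hC (left_mem_language h3)
      have h6 : C * ((u i).length : ℝ) ≤ C * τ := by
        gcongr
        exact hul i hi
      rw [mul_assoc, mul_assoc, ← Real.exp_add, ← Real.exp_add]
      gcongr
      have := mul_le_mul_of_nonneg_left
        (by linarith : supSum X φ (p ++ u i ++ b i) ≤ supSum X φ p + C * τ + supSum X φ (b i)) hs.le
      linarith
    refine le_trans ?_ (Finset.sum_le_sum h2)
    rw [← Finset.mul_sum]
    refine le_trans (le_of_eq ?_) (mul_le_mul_of_nonneg_left hb.le_sum (by positivity))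
    rw [Real.exp_neg (s * (C * τ))]
    field_simp
  have h2 := (Finset.sum_le_sum fun i hi => h i hi (u i) (hul i hi) (huG i hi)).trans
    (sum_massBelow_append_le hb hul w e p)
  rw [← ENNReal.ofReal_sum_of_nonneg fun _ _ => by positivity] at h2
  have h3 := (ENNReal.ofReal_le_ofReal h1).trans h2
  rw [ENNReal.ofReal_mul (by positivity)] at h3
  exact h3.not_gt ((ENNReal.mul_lt_mul_iff_right
    (ENNReal.ofReal_pos.2 (by positivity)).ne' ENNReal.ofReal_ne_top).2 hm)

lemma exists_mem_cylinder_of_isPrefix {p : ℕ → List B} (hp : ∀ j, p j <+: p (j + 1))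
    (hl : ∀ j, j ≤ (p j).length) : ∃ x : ℕ → B, ∀ j, x ∈ cylinder (p j) := by
  have hmono : ∀ {i j}, i ≤ j → p i <+: p j := fun {i j} hij => by
    induction hij with
    | refl => exact List.prefix_rfl
    | step _ ih => exact ih.trans (hp _)
  refine ⟨fun i => (p (i + 1))[i]'(hl (i + 1)), fun j => mem_cylinder_iff.2 fun i hi => ?_⟩
  rcases le_total (i + 1) j with h | h
  · exact (hmono h).getElem _
  · exact ((hmono h).getElem hi).symm

variable [TopologicalSpace B]

lemma exists_path (hXcl : IsClosed X) (hX : MapsTo shift X X) (hC : ∀ x, φ x ≤ C) (hC0 : 0 ≤ C)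
    (hG : G ⊆ language X) (hs : 0 < s)
    (hspec : ∀ v ∈ G, ∀ w ∈ G, ∃ u ∈ language X, u.length ≤ τ ∧ v ++ u ++ w ∈ G) (hN : 0 < N)
    {b : ℕ → List B → List B}
    (hb : ∀ j, BlockFamily X φ G s ((τ + 1) * Real.exp (s * (C * τ))) N W (b j)) {ℓ : ℕ}
    (hℓ : ∀ j, ∀ i ∈ W, (b j i).length ≤ ℓ) (hpos : ∀ j, ∀ i ∈ W, 0 < (b j i).length)
    {p₀ : List B} (hp₀ : p₀ ∈ G) :
    ∃ c₁ : ℝ, 0 < c₁ ∧ ∀ w : ℕ → List B, (∀ n, w n ∈ language X) →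
      ∑' n, ENNReal.ofReal (Real.exp (-(s * supSum X φ (w n)))) < ENNReal.ofReal c₁ →
      ∃ (p : ℕ → List B) (x : X), (∀ j, (x : ℕ → B) ∈ cylinder (p j)) ∧ (∀ j, j ≤ (p j).length) ∧
        (∀ j, ∃ i ∈ W, ∃ u : List B, u.length ≤ τ ∧ p (j + 1) = p j ++ u ++ b j i) ∧
        ∀ n, (x : ℕ → B) ∉ cylinder (w n) := by
  set c := Real.exp (-(s * (C * (τ + ℓ))))
  have hc0 : 0 < c := Real.exp_pos _
  have hc1 : c ≤ 1 := Real.exp_le_one_iff.2 (neg_nonpos.2 (by positivity))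
  refine ⟨c * Real.exp (-(s * (C * p₀.length))), by positivity, fun w hw hsum => ?_⟩
  set e : ℕ → ℝ≥0∞ := fun n => ENNReal.ofReal (Real.exp (-(s * supSum X φ (w n))))
  let St := {p : List B // p ∈ G ∧
    massBelow w e p < ENNReal.ofReal (c * Real.exp (-(s * supSum X φ p)))}
  have h0 : massBelow w e p₀ < ENNReal.ofReal (c * Real.exp (-(s * supSum X φ p₀))) := by
    refine lt_of_le_of_lt ?_ (hsum.trans_le (ENNReal.ofReal_le_ofReal ?_))
    · refine ENNReal.tsum_le_tsum fun n => ?_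
      split_ifs
      exacts [le_rfl, bot_le]
    · have := supSum_le_mul_length hC (hG hp₀)
      gcongr
  have hstep : ∀ (j : ℕ) (p : St), ∃ p' : St, ∃ i ∈ W, ∃ u : List B, u.length ≤ τ ∧
      p'.1 = p.1 ++ u ++ b j i := by
    rintro j ⟨p, hp, hm⟩
    obtain ⟨i, hi, u, hu, huG, hlt⟩ := exists_child hX hC hC0 hG hs hspec hN (hb j) w e hc0 hp hm
    exact ⟨⟨_, huG, hlt⟩, i, hi, u, hu, rfl⟩
  choose next hnext using hstep
  let P : ℕ → St := fun j => Nat.rec ⟨p₀, hp₀, h0⟩ next j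
  have hP : ∀ j, ∃ i ∈ W, ∃ u : List B, u.length ≤ τ ∧
      (P (j + 1)).1 = (P j).1 ++ u ++ b j i := fun j => hnext j (P j)
  have hlen : ∀ j, j ≤ (P j).1.length := by
    intro j
    induction j with
    | zero => exact Nat.zero_le _
    | succ j ih =>
      obtain ⟨i, hi, u, -, h⟩ := hP j
      have := hpos j i hi
      rw [h, List.length_append, List.length_append]
      omega
  have hlen' : ∀ j, (P (j + 1)).1.length ≤ (P j).1.length + (τ + ℓ) := by
    intro j
    obtain ⟨i, hi, u, hu, h⟩ := hP j
    have := hℓ j i hi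
    rw [h, List.length_append, List.length_append]
    omega
  obtain ⟨x, hx⟩ := exists_mem_cylinder_of_isPrefix (p := fun j => (P j).1) (fun j => by
    obtain ⟨i, -, u, -, h⟩ := hP j
    rw [h, List.append_assoc]
    exact List.prefix_append _ _) hlen
  have hxX := mem_of_forall_mem_cylinder hXcl (fun j => hG (P j).2.1) hx hlen
  refine ⟨fun j => (P j).1, ⟨x, hxX⟩, hx, hlen, hP, fun n hn => ?_⟩
  have hex : ∃ j, (w n).length < (P j).1.length := ⟨(w n).length + 1, Nat.lt_of_succ_le (hlen _)⟩
  rcases hj : Nat.find hex with _ | j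
  · have h1 := Nat.find_spec hex
    rw [hj] at h1
    have h2 := (ENNReal.le_tsum n).trans_lt hsum
    rw [ENNReal.ofReal_lt_ofReal_iff (by positivity)] at h2
    have h3 := supSum_le_mul_length hC (hw n)
    have h4 : C * ((w n).length : ℝ) ≤ C * p₀.length := by
      gcongr
      exact h1.le
    refine h2.not_ge ((mul_le_of_le_one_left (Real.exp_pos _).le hc1).trans ?_)
    gcongr
    exact h3.trans h4
  · have h1 := Nat.find_spec hex
    rw [hj] at h1
    have h2 : (P j).1.length ≤ (w n).length :=
      not_lt.1 (Nat.find_min hex (hj ▸ Nat.lt_succ_self j))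
    have hpre := prefix_of_mem_cylinder (hx j) hn h2
    have h3 : e n ≤ massBelow w e (P j).1 := by
      refine le_trans (le_of_eq ?_) (ENNReal.le_tsum n)
      rw [if_pos hpre]
    have h4 := h3.trans_lt (P j).2.2
    rw [ENNReal.ofReal_lt_ofReal_iff (by positivity)] at h4
    have h4 : Real.exp (-(s * supSum X φ (w n))) <
      Real.exp (-(s * (C * (τ + ℓ)))) * Real.exp (-(s * supSum X φ (P j).1)) := h4
    rw [← Real.exp_add, Real.exp_lt_exp] at h4
    obtain ⟨r, hr⟩ := hpre
    have h5 := supSum_append_le_length hX hC (hr ▸ hw n)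
    have h6 : r.length ≤ τ + ℓ := by
      have := hlen' j
      rw [← hr, List.length_append] at h1
      omega
    have h7 : C * (r.length : ℝ) ≤ C * (τ + ℓ) := by
      gcongr
      exact_mod_cast h6
    rw [hr] at h5
    have := mul_le_mul_of_nonneg_left (h5.trans (add_le_add_right h7 _)) hs.le
    linarith

end Descent

section Oscillation

lemma le_of_decreasing_on_block {T : ℕ → ℝ} {R : ℝ} {M : ℕ} (hM : R + 3 ≤ M)
    (hT : ∀ j, |T (j + 1) - T j| ≤ R) {r : ℕ}
    (hdec : ∀ j, M ^ r ≤ j → j < M ^ (r + 1) → T (j + 1) ≤ T j - 1) :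
    T (M ^ (r + 1)) ≤ |T 0| - 2 * M ^ r := by
  have hR : 0 ≤ R := (abs_nonneg _).trans (hT 0)
  have hM1 : 1 ≤ M := by
    have : (1 : ℝ) ≤ M := by linarith
    exact_mod_cast this
  have h1 : ∀ j : ℕ, T j ≤ |T 0| + R * j := by
    intro j
    induction j with
    | zero => simpa using le_abs_self (T 0)
    | succ j ih =>
      have := (abs_le.1 (hT j)).2
      push_cast
      linarith
  have h2 : ∀ k : ℕ, M ^ r + k ≤ M ^ (r + 1) → T (M ^ r + k) ≤ T (M ^ r) - k := by
    intro k
    induction k with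
    | zero => simp
    | succ k ih =>
      intro hk
      have h3 := ih (by omega)
      have h4 := hdec (M ^ r + k) (by omega) (by omega)
      rw [← add_assoc]
      push_cast
      linarith
  obtain ⟨k, hk⟩ := Nat.exists_eq_add_of_le (Nat.pow_le_pow_right hM1 (Nat.le_succ r))
  have h3 := h2 k hk.ge
  rw [← hk] at h3
  have h4 := h1 (M ^ r)
  have h5 : (M : ℝ) ^ r * M = M ^ r + k := by
    rw [← pow_succ]
    exact_mod_cast hk
  have h6 : (M : ℝ) ^ r * (R + 3) ≤ M ^ r * M := by gcongr
  push_cast at h4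
  linarith

lemma frequently_birkAvg_le {Y : Type*} {σ : Y → Y} {f : Y → ℝ} {x : Y} {L : ℕ → ℕ} {E M : ℕ}
    {R : ℝ} (hL : ∀ j, j ≤ L j) (hLE : ∀ j, L (j + 1) ≤ L j + E) (hM : R + 3 ≤ M)
    (hT : ∀ j, |birkhoff σ f (L (j + 1)) x - birkhoff σ f (L j) x| ≤ R)
    (hfreq : ∃ᶠ r in atTop, ∀ j, M ^ r ≤ j → j < M ^ (r + 1) →
      birkhoff σ f (L (j + 1)) x ≤ birkhoff σ f (L j) x - 1) :
    ∃ᶠ n in atTop, birkAvg σ f n x ≤ -(1 / (L 0 + M * E + 1)) := by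
  have hR : 0 ≤ R := (abs_nonneg _).trans (hT 0)
  have hM1 : 1 < M := by
    have : (1 : ℝ) < M := by linarith
    exact_mod_cast this
  have hLj : ∀ j, L j ≤ L 0 + j * E := by
    intro j
    induction j with
    | zero => simp
    | succ j ih =>
      have := hLE j
      rw [add_mul]
      omega
  have hpow : Tendsto (fun r : ℕ => (M : ℝ) ^ r) atTop atTop :=
    tendsto_pow_atTop_atTop_of_one_lt (by exact_mod_cast hM1)
  have htend : Tendsto (fun r : ℕ => L (M ^ (r + 1))) atTop atTop :=
    tendsto_atTop_mono (fun r => ((Nat.lt_pow_self hM1).le.trans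
      (Nat.pow_le_pow_right hM1.le (Nat.le_succ r))).trans (hL _)) tendsto_id
  refine htend.frequently ((hfreq.and_eventually
    (hpow.eventually_ge_atTop |birkhoff σ f (L 0) x|)).mono ?_)
  rintro r ⟨hdec, hr⟩
  have h1 := le_of_decreasing_on_block (T := fun j => birkhoff σ f (L j) x) hM hT hdec
  have h2 : birkhoff σ f (L (M ^ (r + 1))) x ≤ -(M : ℝ) ^ r := by linarith
  have hp : (1 : ℝ) ≤ (M : ℝ) ^ r := one_le_pow₀ (by exact_mod_cast hM1.le)
  have h3 : (L (M ^ (r + 1)) : ℝ) ≤ M ^ r * (L 0 + M * E + 1) := by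
    have h4 : (L (M ^ (r + 1)) : ℝ) ≤ L 0 + M ^ (r + 1) * E := by exact_mod_cast hLj (M ^ (r + 1))
    have h5 : (L 0 : ℝ) ≤ M ^ r * L 0 := le_mul_of_one_le_left (Nat.cast_nonneg _) hp
    rw [pow_succ (M : ℝ)] at h4
    linarith
  have hpos : (0 : ℝ) < L (M ^ (r + 1)) := by
    exact_mod_cast (Nat.pow_pos (by omega)).trans_le (hL _)
  rw [birkAvg, inv_mul_eq_div, div_le_iff₀ hpos]
  refine h2.trans ?_
  rw [neg_mul, neg_le_neg_iff, one_div, inv_mul_le_iff₀ (by positivity)]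
  linarith

lemma mem_irregular_of_alternating {Y : Type*} {σ : Y → Y} {f : Y → ℝ} {x : Y} {L : ℕ → ℕ}
    {E M : ℕ} {R : ℝ} (hL : ∀ j, j ≤ L j) (hLE : ∀ j, L (j + 1) ≤ L j + E) (hM : R + 3 ≤ M)
    (hT : ∀ j, |birkhoff σ f (L (j + 1)) x - birkhoff σ f (L j) x| ≤ R)
    (heven : ∀ j, Even (Nat.log M j) →
      birkhoff σ f (L (j + 1)) x ≤ birkhoff σ f (L j) x - 1)
    (hodd : ∀ j, ¬ Even (Nat.log M j) →
      birkhoff σ f (L j) x + 1 ≤ birkhoff σ f (L (j + 1)) x) : x ∈ irregular σ f := by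
  rintro ⟨a, ha⟩
  have hκ : (0 : ℝ) < 1 / (L 0 + M * E + 1) := by positivity
  have h1 := frequently_birkAvg_le hL hLE hM hT <| by
    refine Nat.frequently_even.mono fun r hr j h1 h2 => heven j ?_
    rwa [Nat.log_eq_of_pow_le_of_lt_pow h1 h2]
  have h2 := frequently_birkAvg_le (σ := σ) (f := fun y => -f y) (x := x) hL hLE hM
    (by
      intro j
      rw [birkhoff_neg, birkhoff_neg, neg_sub_neg, abs_sub_comm]
      exact hT j) <| by
    refine Nat.frequently_odd.mono fun r hr j h1 h2 => ?_
    have := hodd j (by rwa [Nat.log_eq_of_pow_le_of_lt_pow h1 h2, Nat.not_even_iff_odd])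
    rw [birkhoff_neg, birkhoff_neg]
    linarith
  have h3 : a ≤ -(1 / (L 0 + M * E + 1)) := le_of_tendsto_of_frequently ha h1
  have h4 : -a ≤ -(1 / (L 0 + M * E + 1)) := le_of_tendsto_of_frequently ha.neg <| by
    refine h2.mono fun n hn => ?_
    rwa [birkAvg, birkhoff_neg, mul_neg] at hn
  linarith

lemma mem_irregular_of_sub_const {Y : Type*} {σ : Y → Y} {f : Y → ℝ} {θ : ℝ} {x : Y}
    (h : x ∈ irregular σ fun y => f y - θ) : x ∈ irregular σ f := by
  rintro ⟨a, ha⟩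
  refine h ⟨a - θ, (ha.sub_const θ).congr' ?_⟩
  filter_upwards [eventually_gt_atTop 0] with n hn
  have : (n : ℝ) ≠ 0 := by positivity
  rw [birkAvg, birkAvg, birkhoff_sub_const]
  field_simp

end Oscillation

section Main

variable {B : Type} {X : Set (ℕ → B)} {φ ψ : X → ℝ} {G : Set (List B)}

lemma hMeasAux_irregular_ne_zero [Fintype B] [TopologicalSpace B] [DiscreteTopology B]
    (hXcl : IsClosed X) (hX : MapsTo shift X X) (hφ : Continuous φ) (hφpos : ∀ x, 0 < φ x)
    (hG : G ⊆ language X) (hspec : HasSpecW (language X) G)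
    (happ : EditApproachable (language X) G) (hψ : Continuous ψ) {x₀ : X}
    (hx₀ : x₀ ∈ irregular (subShift X) ψ) {s : ℝ} (hs : 0 < s)
    (hsd : s < hdim (dphi X φ) univ) :
    hMeasAux (dphi X φ) s 1 (irregular (subShift X) ψ) ≠ 0 := by
  have : Nonempty X := ⟨x₀⟩
  obtain ⟨C, hC0, hCabs⟩ := exists_abs_le hXcl hφ
  have hC : ∀ x, φ x ≤ C := fun x => (le_abs_self _).trans (hCabs x)
  obtain ⟨c, hc0, hc⟩ := exists_pos_le hXcl hφ hφpos
  obtain ⟨C₂, hC₂0, hC₂⟩ := exists_abs_le hXcl hψ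
  obtain ⟨δ, hδ, hgrowth⟩ := exists_exp_le_sum hXcl hX hφ hφpos hC hc0 hc hs hsd
  obtain ⟨α, β, hαβ, hdev⟩ := exists_lt_of_mem_irregular hC₂ hx₀
  obtain ⟨p₀, hp₀⟩ : G.Nonempty := by
    obtain ⟨g, -, h⟩ := happ
    obtain ⟨v, hv, -⟩ := h [] (prefixWord_mem_language x₀ 0)
    exact ⟨v, hv⟩
  obtain ⟨τ, hτ⟩ := hspec
  obtain ⟨θ, N, W, b₁, b₂, hθ, hN, hf₁, hf₂, hd₁, hd₂⟩ :=
    exists_blockFamily hXcl hX hφ hC0 hC hG hτ happ hψ hC₂0 hC₂ hs hδ hgrowth hαβ hdev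
      ((τ + 1) * Real.exp (s * (C * τ))) (2 * C₂ * τ + 1)
  set f : X → ℝ := fun y => ψ y - θ
  have hfb : ∀ y, |f y| ≤ 2 * C₂ := fun y => by
    have := abs_sub (ψ y) θ
    linarith [hC₂ y]
  set ℓ := W.sup fun i => max (b₁ i).length (b₂ i).length
  have hW : ∀ i ∈ W, max (b₁ i).length (b₂ i).length ≤ ℓ := fun i hi =>
    Finset.le_sup (f := fun i => max (b₁ i).length (b₂ i).length) hi
  obtain ⟨M, hM⟩ := exists_nat_ge (2 * C₂ * (τ + ℓ) + 3)
  set b : ℕ → List B → List B := fun j => if Even (Nat.log M j) then b₁ else b₂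
  have hbe : ∀ {j}, Even (Nat.log M j) → b j = b₁ := fun h => if_pos h
  have hbo : ∀ {j}, ¬ Even (Nat.log M j) → b j = b₂ := fun h => if_neg h
  have hD : 0 < 2 * C₂ * τ + 1 := by positivity
  have hne : ∀ b' ∈ ({b₁, b₂} : Set (List B → List B)), ∀ i ∈ W, 0 < (b' i).length := by
    have hcyl : ∀ {w : List B}, w.length = 0 → (x₀ : ℕ → B) ∈ cylinder w := fun hw => by
      rw [List.eq_nil_of_length_eq_zero hw]
      exact mem_cylinder_prefixWord (x₀ : ℕ → B) 0
    rintro b' (rfl | rfl) i hi <;> by_contra! h0 <;> have h0 := Nat.le_zero.1 h0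
    · have := hd₁ i hi x₀ (hcyl h0)
      rw [h0, birkhoff_zero] at this
      linarith
    · have := hd₂ i hi x₀ (hcyl h0)
      rw [h0, birkhoff_zero] at this
      linarith
  obtain ⟨c₁, hc₁, hpath⟩ := exists_path hXcl hX hC hC0.le hG hs hτ hN (b := b)
    (fun j => by
      by_cases h : Even (Nat.log M j)
      exacts [(hbe h).symm ▸ hf₁, (hbo h).symm ▸ hf₂]) (ℓ := ℓ)
    (fun j i hi => by
      by_cases h : Even (Nat.log M j)
      · rw [hbe h]; exact (le_max_left _ _).trans (hW i hi)
      · rw [hbo h]; exact (le_max_right _ _).trans (hW i hi))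
    (fun j i hi => by
      by_cases h : Even (Nat.log M j)
      · rw [hbe h]; exact hne b₁ (by simp) i hi
      · rw [hbo h]; exact hne b₂ (by simp) i hi) hp₀
  refine hMeasAux_dphi_ne_zero hC hc0 hc hs hc₁ fun w hw hsum => ?_
  obtain ⟨p, x, hx, hlen, hp, hxw⟩ := hpath w hw hsum
  refine ⟨x, mem_irregular_of_sub_const (θ := θ) ?_, hxw⟩
  have step : ∀ j, ∃ i ∈ W, ∃ u : List B, u.length ≤ τ ∧
      (p (j + 1)).length = (p j).length + u.length + (b j i).length ∧
      ∃ y z : X, (z : ℕ → B) ∈ cylinder (b j i) ∧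
        birkhoff (subShift X) f (p (j + 1)).length x = birkhoff (subShift X) f (p j).length x +
          birkhoff (subShift X) f u.length y + birkhoff (subShift X) f (b j i).length z := by
    intro j
    obtain ⟨i, hi, u, hu, h⟩ := hp j
    have h1 := hx (j + 1)
    rw [h] at h1
    have h2 := (mem_cylinder_append.1 h1).2
    rw [← coe_subShift_iterate hX] at h2
    refine ⟨i, hi, u, hu, by rw [h, List.length_append, List.length_append],
      (subShift X)^[(p j).length] x, _, h2, ?_⟩
    rw [h, List.length_append, birkhoff_add, List.length_append, birkhoff_add]
  have hub : ∀ (u : List B) (y : X), u.length ≤ τ →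
      |birkhoff (subShift X) f u.length y| ≤ 2 * C₂ * τ := fun u y hu =>
    (abs_birkhoff_le _ hfb _ _).trans (by gcongr)
  refine mem_irregular_of_alternating (L := fun j => (p j).length) (E := τ + ℓ) (M := M)
    (R := 2 * C₂ * (τ + ℓ)) hlen (fun j => ?_) hM (fun j => ?_) (fun j hj => ?_) fun j hj => ?_ <;>
    obtain ⟨i, hi, u, hu, h1, y, z, hz, h2⟩ := step j
  · have h3 : (b j i).length ≤ ℓ := by
      by_cases h : Even (Nat.log M j)
      · rw [hbe h]; exact (le_max_left _ _).trans (hW i hi)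
      · rw [hbo h]; exact (le_max_right _ _).trans (hW i hi)
    omega
  · have h3 : (b j i).length ≤ ℓ := by
      by_cases h : Even (Nat.log M j)
      · rw [hbe h]; exact (le_max_left _ _).trans (hW i hi)
      · rw [hbo h]; exact (le_max_right _ _).trans (hW i hi)
    have h4 : |birkhoff (subShift X) f (b j i).length z| ≤ 2 * C₂ * ℓ :=
      (abs_birkhoff_le _ hfb _ _).trans (by gcongr)
    have h5 := hub u y hu
    rw [h2, add_assoc, add_sub_cancel_left]
    refine (abs_add_le _ _).trans ?_
    linarith
  · have h3 := (abs_le.1 (hub u y hu)).2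
    rw [hbe hj] at hz h2
    have h4 := hd₁ i hi z hz
    linarith
  · have h3 := (abs_le.1 (hub u y hu)).1
    rw [hbo hj] at hz h2
    have h4 := hd₂ i hi z hz
    linarith

end Main

/-- the irregular set is either empty or has full Hausdorff dimension
w.r.t. the metric `d_φ`. -/
theorem statement_14 {A : Type} [Fintype A] [DecidableEq A] [TopologicalSpace A]
    [DiscreteTopology A] [MeasurableSpace A] [BorelSpace A]
    (X : Set (ℕ → A)) (hXcl : IsClosed X) (hXinv : Set.MapsTo shift X X)
    (φ : ↥X → ℝ) (hφ : Continuous φ) (hφpos : ∀ x, 0 < φ x)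
    (G : Set (List A)) (hG : G ⊆ language X)
    (hspec : HasSpecW (language X) G) (happ : EditApproachable (language X) G)
    (ψ : ↥X → ℝ) (hψ : Continuous ψ) :
    irregular (subShift X) ψ = ∅ ∨
      hdim (dphi X φ) (irregular (subShift X) ψ) = hdim (dphi X φ) Set.univ := by
  refine (Set.eq_empty_or_nonempty _).imp_right ?_
  rintro ⟨x₀, hx₀⟩
  obtain ⟨C, -, hC⟩ := exists_abs_le hXcl hφ
  obtain ⟨c, hc0, hc⟩ := exists_pos_le hXcl hφ hφpos
  obtain ⟨t, ht0, ht⟩ := exists_hMeas_univ_eq_zero (fun x => (le_abs_self _).trans (hC x)) hc0 hc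
  have hzero : ∀ {r : ℝ}, hMeas (dphi X φ) r univ = 0 →
      hMeas (dphi X φ) r (irregular (subShift X) ψ) = 0 := fun h =>
    le_antisymm (h ▸ hMeas_mono (subset_univ _)) bot_le
  refine le_antisymm (csInf_le_csInf (bddBelow_hdim _ _) ⟨t, ht0, ht⟩
    fun r hr => ⟨hr.1, hzero hr.2⟩) (le_csInf ⟨t, ht0, hzero ht⟩ ?_)
  rintro r ⟨hr0, hr⟩
  by_contra! hlt
  obtain ⟨s, hrs, hsd⟩ := exists_between hlt
  exact hMeasAux_irregular_ne_zero hXcl hXinv hφ hφpos hG hspec happ hψ hx₀ (hr0.trans_lt hrs) hsd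
    (hMeas_anti_zero hrs.le hr)

end Paper
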